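/- Suppose Γ is not a Dynkin diagram of type A, D, or E. Then for every S ∈ 𝔖: (a) the word w(S) ∈ W is reduced; and (b) there exists a preprojective k(Γ,Λ)-module M satisfying S ∼ S_M. -/

import Mathlib

namespace KP

/-! ## Quivers on a fixed vertex set `Fin n`.

An orientation is encoded by `Λ : Fin n → Fin n → ℕ`, where `Λ a b` is the number of
arrows from `a` to `b`.  The underlying graph is recorded by `edges Λ a b = Λ a b + Λ b a`. -/

/-- The orientation `σ_x Λ` obtained by reversing every arrow incident with `x`. -/
def flipO {n : ℕ} (x : Fin n) (Λ : Fin n → Fin n → ℕ) : Fin n → Fin n → ℕ :=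
  fun a b => if a = x ∨ b = x then Λ b a else Λ a b

/-- Number of edges of the underlying graph joining `a` and `b`. -/
def edges {n : ℕ} (Λ : Fin n → Fin n → ℕ) (a b : Fin n) : ℕ := Λ a b + Λ b a

/-- `x` is a sink: no arrow starts at `x`. -/
def IsSink {n : ℕ} (Λ : Fin n → Fin n → ℕ) (x : Fin n) : Prop := ∀ y, Λ x y = 0

/-- `S` is a `(+)`-admissible sequence of vertices on `(Γ, Λ)`. -/
def Admissible {n : ℕ} (Λ : Fin n → Fin n → ℕ) : List (Fin n) → Prop
  | [] => True
  | x :: xs => IsSink Λ x ∧ Admissible (flipO x Λ) xs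

/-- The orientation `Λ^S`. -/
def orientAfter {n : ℕ} (Λ : Fin n → Fin n → ℕ) : List (Fin n) → (Fin n → Fin n → ℕ)
  | [] => Λ
  | x :: xs => orientAfter (flipO x Λ) xs

/-- Elementary move: interchange two consecutive vertices not joined by an edge. -/
inductive SwapRel {n : ℕ} (E : Fin n → Fin n → ℕ) : List (Fin n) → List (Fin n) → Prop
  | swap (l₁ l₂ : List (Fin n)) (a b : Fin n) (h : E a b = 0) :
      SwapRel E (l₁ ++ a :: b :: l₂) (l₁ ++ b :: a :: l₂)

/-- The equivalence `∼` on sequences of vertices: reflexive–transitive closure of the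
(symmetric) relation `SwapRel`. -/
def Sim {n : ℕ} (E : Fin n → Fin n → ℕ) : List (Fin n) → List (Fin n) → Prop :=
  Relation.ReflTransGen (SwapRel E)

/-- The preorder `S ⪯ T` : `T ∼ S ++ U` for some `(+)`-admissible sequence `U` on `(Γ, Λ^S)`. -/
def Preceq {n : ℕ} (Λ : Fin n → Fin n → ℕ) (S T : List (Fin n)) : Prop :=
  ∃ U, Admissible (orientAfter Λ S) U ∧ Sim (edges Λ) T (S ++ U)

/-- Support of a sequence of vertices. -/
def suppOf {n : ℕ} (S : List (Fin n)) : Set (Fin n) := {v | v ∈ S}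

/-- The partial order on vertices: `x ≤ y` iff there is a path from `x` to `y` in `(Γ, Λ)`. -/
def PathLE {n : ℕ} (Λ : Fin n → Fin n → ℕ) (x y : Fin n) : Prop :=
  Relation.ReflTransGen (fun a b => Λ a b ≠ 0) x y

/-- A filter (up-closed set) of the poset `(Γ₀, Λ)`. -/
def IsFilter {n : ℕ} (Λ : Fin n → Fin n → ℕ) (F : Set (Fin n)) : Prop :=
  ∀ x ∈ F, ∀ y, PathLE Λ x y → y ∈ F

/-- The principal filter `⟨x⟩`. -/
def upSet {n : ℕ} (Λ : Fin n → Fin n → ℕ) (x : Fin n) : Set (Fin n) := {y | PathLE Λ x y}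

/-- The hull `H_Λ(F)`: the smallest filter containing `F` and every vertex joined
by an edge to a vertex of `F`. -/
def hull {n : ℕ} (Λ : Fin n → Fin n → ℕ) (F : Set (Fin n)) : Set (Fin n) :=
  {y | ∃ x, (x ∈ F ∨ ∃ z ∈ F, edges Λ z x ≠ 0) ∧ PathLE Λ x y}

/-- `segs` is a canonical form of `S` (Proposition 2.1): `S ∼ S₁S₂⋯S_r`, each segment
consists of distinct vertices, is nonempty, and `Supp S_i = Supp (S_i S_{i+1} ⋯ S_r)`. -/
def Segments {n : ℕ} (Λ : Fin n → Fin n → ℕ) (S : List (Fin n))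
    (segs : List (List (Fin n))) : Prop :=
  Admissible Λ segs.flatten ∧ Sim (edges Λ) S segs.flatten ∧
  (∀ seg ∈ segs, seg ≠ [] ∧ seg.Nodup) ∧
  ∀ i, i < segs.length → suppOf (segs.getD i []) = suppOf ((segs.drop i).flatten)

/-- `J` is (a representative of) the join `S ∨ T` (Definition 2.4):  the canonical form of `J`
has `Supp R_i = Supp S_i ∪ Supp T_i` (out-of-range segments read as `∅`). -/
def IsJoin {n : ℕ} (Λ : Fin n → Fin n → ℕ) (S T J : List (Fin n)) : Prop :=
  ∃ CS CT CJ, Segments Λ S CS ∧ Segments Λ T CT ∧ Segments Λ J CJ ∧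
    ∀ i, suppOf (CJ.getD i []) = suppOf (CS.getD i []) ∪ suppOf (CT.getD i [])

/-- `M` is (a representative of) the meet `S ∧ T` (Definition 2.4). -/
def IsMeet {n : ℕ} (Λ : Fin n → Fin n → ℕ) (S T M : List (Fin n)) : Prop :=
  ∃ CS CT CM, Segments Λ S CS ∧ Segments Λ T CT ∧ Segments Λ M CM ∧
    ∀ i, suppOf (CM.getD i []) = suppOf (CS.getD i []) ∩ suppOf (CT.getD i [])

/-- `S` is (equivalent to) the join `T₁ ∨ ⋯ ∨ T_l` of the list of sequences `Ts`. -/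
def IsJoinList {n : ℕ} (Λ : Fin n → Fin n → ℕ) : List (List (Fin n)) → List (Fin n) → Prop
  | [], S => S = []
  | T :: Ts, S => ∃ J, IsJoinList Λ Ts J ∧ IsJoin Λ T J S

/-- The segments of a canonical form of a principal sequence `S_{r,x}` (Definition 3.1). -/
def PrincipalSegs {n : ℕ} (Λ : Fin n → Fin n → ℕ) (segs : List (List (Fin n)))
    (r : ℕ) (x : Fin n) : Prop :=
  segs.length = r ∧ 0 < r ∧
  (∀ i, i + 1 < r → suppOf (segs.getD i []) = hull Λ (suppOf (segs.getD (i+1) []))) ∧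
  suppOf (segs.getD (r-1) []) = upSet Λ x

/-- `S ∼ S_{r,x}`, the principal `(+)`-admissible sequence of size `r` with
`Supp S_r = ⟨x⟩`. -/
def IsPrincipalSeq {n : ℕ} (Λ : Fin n → Fin n → ℕ) (r : ℕ) (x : Fin n)
    (S : List (Fin n)) : Prop :=
  ∃ segs, Segments Λ S segs ∧ PrincipalSegs Λ segs r x

/-- `S` is a principal `(+)`-admissible sequence. -/
def IsPrincipal {n : ℕ} (Λ : Fin n → Fin n → ℕ) (S : List (Fin n)) : Prop :=
  ∃ r x, IsPrincipalSeq Λ r x S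


/-! ## Representations of `(Γ, Λ)` over a field `k`. -/

/-- A (finite-dimensional) representation of the quiver `(Γ, Λ)` over `k`:
the space at vertex `x` is `Fin (d x) → k`, and each arrow carries a linear map. -/
structure Rep (k : Type) [Field k] (n : ℕ) (Λ : Fin n → Fin n → ℕ) where
  d : Fin n → ℕ
  f : ∀ a b : Fin n, Fin (Λ a b) → ((Fin (d a) → k) →ₗ[k] (Fin (d b) → k))

variable {k : Type} [Field k] {n : ℕ}

/-- A morphism of representations. -/
structure RepHom {Λ : Fin n → Fin n → ℕ} (M N : Rep k n Λ) where
  g : ∀ x, (Fin (M.d x) → k) →ₗ[k] (Fin (N.d x) → k)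
  comm : ∀ a b i v, g b (M.f a b i v) = N.f a b i (g a v)

/-- Isomorphism of representations. -/
def RepIso {Λ : Fin n → Fin n → ℕ} (M N : Rep k n Λ) : Prop :=
  ∃ g : ∀ x, (Fin (M.d x) → k) ≃ₗ[k] (Fin (N.d x) → k),
    ∀ a b i v, g b (M.f a b i v) = N.f a b i (g a v)

/-- The zero representation. -/
def IsZeroRep {Λ : Fin n → Fin n → ℕ} (M : Rep k n Λ) : Prop := ∀ x, M.d x = 0

/-- Cast between the standard spaces. -/
def castL (k : Type) [Field k] {m m' : ℕ} (h : m = m') : (Fin m → k) ≃ₗ[k] (Fin m' → k) :=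
  LinearEquiv.funCongrLeft k k (finCongr h.symm)

/-- The splitting `(Fin (m + p) → k) ≃ₗ (Fin m → k) × (Fin p → k)`. -/
def splitL (k : Type) [Field k] (m p : ℕ) : (Fin (m + p) → k) ≃ₗ[k] (Fin m → k) × (Fin p → k) :=
  (LinearEquiv.funCongrLeft k k finSumFinEquiv).trans
    (LinearEquiv.sumArrowLequivProdArrow _ _ k k)

/-- Direct sum of two representations. -/
def dSum {Λ : Fin n → Fin n → ℕ} (M N : Rep k n Λ) : Rep k n Λ where
  d x := M.d x + N.d x
  f a b i :=
    (splitL k (M.d b) (N.d b)).symm.toLinearMap ∘ₗ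
      (LinearMap.prodMap (M.f a b i) (N.f a b i)) ∘ₗ (splitL k (M.d a) (N.d a)).toLinearMap

/-- The zero representation (as an object). -/
def zeroRep (k : Type) [Field k] (n : ℕ) (Λ : Fin n → Fin n → ℕ) : Rep k n Λ where
  d _ := 0
  f _ _ _ := 0

/-- Direct sum of a list of representations. -/
def dSumList {Λ : Fin n → Fin n → ℕ} (L : List (Rep k n Λ)) : Rep k n Λ :=
  L.foldr dSum (zeroRep k n Λ)

/-- `M` is indecomposable. -/
def Indecomp {Λ : Fin n → Fin n → ℕ} (M : Rep k n Λ) : Prop :=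
  ¬ IsZeroRep M ∧ ∀ A B : Rep k n Λ, RepIso M (dSum A B) → IsZeroRep A ∨ IsZeroRep B

/-- `X` is a direct summand of `M`. -/
def IsSummand {Λ : Fin n → Fin n → ℕ} (X M : Rep k n Λ) : Prop :=
  ∃ Y, RepIso M (dSum X Y)

/-! ### Reflection functors (on objects) -/

/-- Index type of the arrows ending at `x`. -/
abbrev Arin {n : ℕ} (Λ : Fin n → Fin n → ℕ) (x : Fin n) := Σ y : Fin n, Fin (Λ y x)

/-- Index type of the arrows starting at `x`. -/
abbrev Aout {n : ℕ} (Λ : Fin n → Fin n → ℕ) (x : Fin n) := Σ y : Fin n, Fin (Λ x y)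

/-- The map `h : ⊕_{a : y → x} V(y) → V(x)` induced by the maps along the arrows ending at `x`. -/
noncomputable def inMap (Λ : Fin n → Fin n → ℕ) (M : Rep k n Λ) (x : Fin n) :
    ((p : Arin Λ x) → (Fin (M.d p.1) → k)) →ₗ[k] (Fin (M.d x) → k) :=
  ∑ p : Arin Λ x, (M.f p.1 x p.2) ∘ₗ LinearMap.proj p

/-- The map `h' : V(x) → ⊕_{a : x → y} V(y)` induced by the maps along arrows starting at `x`. -/
def outMap (Λ : Fin n → Fin n → ℕ) (M : Rep k n Λ) (x : Fin n) :
    (Fin (M.d x) → k) →ₗ[k] ((p : Aout Λ x) → (Fin (M.d p.1) → k)) :=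
  LinearMap.pi fun p => M.f x p.1 p.2

noncomputable def kerEquiv (Λ : Fin n → Fin n → ℕ) (M : Rep k n Λ) (x : Fin n) :
    LinearMap.ker (inMap Λ M x) ≃ₗ[k]
      (Fin (Module.finrank k (LinearMap.ker (inMap Λ M x))) → k) :=
  (Module.finBasis k _).equivFun

noncomputable def cokerEquiv (Λ : Fin n → Fin n → ℕ) (M : Rep k n Λ) (x : Fin n) :
    (((p : Aout Λ x) → (Fin (M.d p.1) → k)) ⧸ LinearMap.range (outMap Λ M x)) ≃ₗ[k]
      (Fin (Module.finrank k (((p : Aout Λ x) → (Fin (M.d p.1) → k)) ⧸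
        LinearMap.range (outMap Λ M x))) → k) :=
  (Module.finBasis k _).equivFun

/-- The positive reflection functor `F_x⁺` (on objects): the space at `x` is replaced
by the kernel of `inMap`, with the maps along the reversed arrows induced by inclusion
followed by the projections. -/
noncomputable def reflPlus (x : Fin n) (Λ : Fin n → Fin n → ℕ) (M : Rep k n Λ) :
    Rep k n (flipO x Λ) where
  d z := if z = x then Module.finrank k (LinearMap.ker (inMap Λ M x)) else M.d z
  f a b i :=
    if ha : a = x then
      if hb : b = x then 0
      else
        (castL k (if_neg hb).symm).toLinearMap ∘ₗ
          (LinearMap.proj (φ := fun p : Arin Λ x => Fin (M.d p.1) → k)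
            (⟨b, Fin.cast (by subst ha; simp [flipO]) i⟩ : Arin Λ x)) ∘ₗ
          (LinearMap.ker (inMap Λ M x)).subtype ∘ₗ
          (kerEquiv Λ M x).symm.toLinearMap ∘ₗ (castL k (if_pos ha)).toLinearMap
    else
      if hb : b = x then 0
      else
        (castL k (if_neg hb).symm).toLinearMap ∘ₗ
          M.f a b (Fin.cast (by simp [flipO, ha, hb]) i) ∘ₗ
          (castL k (if_neg ha)).toLinearMap

/-- The negative reflection functor `F_x⁻` (on objects), presented as a map from
representations of `(Γ, σ_x Λ)` to representations of `(Γ, Λ)`: the space at `x` is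
replaced by the cokernel of `outMap`. -/
noncomputable def reflMinus (x : Fin n) (Λ : Fin n → Fin n → ℕ)
    (N : Rep k n (flipO x Λ)) : Rep k n Λ where
  d z := if z = x then
      Module.finrank k (((p : Aout (flipO x Λ) x) → (Fin (N.d p.1) → k)) ⧸
        LinearMap.range (outMap (flipO x Λ) N x))
    else N.d z
  f a b i :=
    if hb : b = x then
      if ha : a = x then 0
      else
        (castL k (if_pos hb).symm).toLinearMap ∘ₗ
          (cokerEquiv (flipO x Λ) N x).toLinearMap ∘ₗ
          (LinearMap.range (outMap (flipO x Λ) N x)).mkQ ∘ₗ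
          (LinearMap.single k (fun p : Aout (flipO x Λ) x => Fin (N.d p.1) → k)
            (⟨a, Fin.cast (by subst hb; simp [flipO]) i⟩ : Aout (flipO x Λ) x)) ∘ₗ
          (castL k (if_neg ha)).toLinearMap
    else
      if ha : a = x then 0
      else
        (castL k (if_neg hb).symm).toLinearMap ∘ₗ
          N.f a b (Fin.cast (by simp [flipO, ha, hb]) i) ∘ₗ
          (castL k (if_neg ha)).toLinearMap

/-- `F(S) = F_{x_s}⁺ ⋯ F_{x_1}⁺` applied to a representation. -/
noncomputable def FList : (S : List (Fin n)) → (Λ : Fin n → Fin n → ℕ) → Rep k n Λ →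
    Rep k n (orientAfter Λ S)
  | [], _, M => M
  | x :: xs, Λ, M => FList xs (flipO x Λ) (reflPlus x Λ M)

/-- `S` annihilates `M` : `F(S) M = 0`. -/
def Annihilates (Λ : Fin n → Fin n → ℕ) (S : List (Fin n)) (M : Rep k n Λ) : Prop :=
  IsZeroRep (FList S Λ M)

/-- `M` is preprojective: some `(+)`-admissible sequence annihilates it. -/
def Preprojective (Λ : Fin n → Fin n → ℕ) (M : Rep k n Λ) : Prop :=
  ∃ S, Admissible Λ S ∧ Annihilates Λ S M

/-- `S` is a shortest `(+)`-admissible sequence annihilating `M` : it annihilates `M` and no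
proper subsequence of `S` annihilates `M`.  (This predicate is invariant under `∼`, so it
expresses `S ∼ S_M`.) -/
def IsShortestAnn (Λ : Fin n → Fin n → ℕ) (M : Rep k n Λ) (S : List (Fin n)) : Prop :=
  Admissible Λ S ∧ Annihilates Λ S M ∧
  ∀ S', Admissible Λ S' → Annihilates Λ S' M → Preceq Λ S' S → Sim (edges Λ) S' S

/-- The simple representation `L_x` concentrated at the vertex `x`. -/
def simpleRep (Λ : Fin n → Fin n → ℕ) (x : Fin n) : Rep k n Λ where
  d z := if z = x then 1 else 0
  f _ _ _ := 0

/-- `M(S) = F_{x₁}⁻ F_{x₂}⁻ ⋯ F_{x_{s-1}}⁻ (L_{x_s})`, where `L_{x_s}` is the simple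
(projective) module over `k(Γ, σ_{x_{s-1}} ⋯ σ_{x_1} Λ)` at the vertex `x_s`. -/
noncomputable def Mof : (Λ : Fin n → Fin n → ℕ) → (S : List (Fin n)) → Rep k n Λ
  | Λ, [] => zeroRep k n Λ
  | Λ, [x] => simpleRep Λ x
  | Λ, x :: y :: ys => reflMinus x Λ (Mof (flipO x Λ) (y :: ys))

variable {n : ℕ}

/-! ## The Weyl group -/

/-- The simple reflection `σ_i` attached to a generalized Cartan matrix `A`,
as a linear endomorphism of `ℤⁿ` : `σ_i(v) = v - (∑ l, a_{il} v_l) e_i`. -/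
def sigmaL (A : Fin n → Fin n → ℤ) (i : Fin n) : (Fin n → ℤ) →ₗ[ℤ] (Fin n → ℤ) where
  toFun v := v - (∑ l, A i l * v l) • Pi.single i 1
  map_add' v w := by
    simp only [Pi.add_apply, mul_add, Finset.sum_add_distrib, add_smul]
    abel
  map_smul' c v := by
    simp only [Pi.smul_apply, smul_eq_mul, RingHom.id_apply, smul_sub]
    congr 1
    rw [smul_smul, Finset.mul_sum]
    congr 1
    exact Finset.sum_congr rfl fun l _ => by ring

theorem sigma_invol (A : Fin n → Fin n → ℤ) (hA : ∀ i, A i i = 2) (i : Fin n) :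
    (sigmaL A i).comp (sigmaL A i) = LinearMap.id := by
  apply LinearMap.ext
  intro v
  simp only [LinearMap.comp_apply, LinearMap.id_apply, sigmaL, LinearMap.coe_mk, AddHom.coe_mk]
  set c := ∑ l, A i l * v l with hc
  set s : Fin n → ℤ := Pi.single i 1 with hs
  have h1 : ∑ l, A i l * (v - c • s) l = -c := by
    have h2 : ∀ l, A i l * (v - c • s) l = A i l * v l - c * (A i l * s l) := fun l => by
      simp only [Pi.sub_apply, Pi.smul_apply, smul_eq_mul]
      ring
    rw [Finset.sum_congr rfl fun l _ => h2 l, Finset.sum_sub_distrib, ← Finset.mul_sum]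
    have h3 : ∑ l, A i l * s l = 2 := by
      rw [Finset.sum_eq_single i]
      · simp [hs, hA i]
      · intro b _ hb
        simp [hs, Pi.single_eq_of_ne hb]
      · simp
    rw [h3, ← hc]
    ring
  rw [h1]
  ext j
  simp only [Pi.sub_apply, Pi.smul_apply, smul_eq_mul]
  ring

/-- The simple reflection `σ_i` as an automorphism of `ℤⁿ`. -/
def sigmaE (A : Fin n → Fin n → ℤ) (hA : ∀ i, A i i = 2) (i : Fin n) :
    (Fin n → ℤ) ≃ₗ[ℤ] (Fin n → ℤ) :=
  LinearEquiv.ofLinear (sigmaL A i) (sigmaL A i) (sigma_invol A hA i) (sigma_invol A hA i)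

/-- The length `ℓ(w)`: the least `l ≥ 0` such that `w` is a product of `l` simple
reflections. -/
noncomputable def wordLen (A : Fin n → Fin n → ℤ) (hA : ∀ i, A i i = 2)
    (w : (Fin n → ℤ) ≃ₗ[ℤ] (Fin n → ℤ)) : ℕ :=
  sInf {l | ∃ ys : List (Fin n), ys.length = l ∧ w = (ys.map (sigmaE A hA)).prod}

/-- The word `w(S) = σ_{x_s} ⋯ σ_{x_1}` associated to a sequence `S = x₁, …, x_s`. -/
def wordOf (A : Fin n → Fin n → ℤ) (hA : ∀ i, A i i = 2) (S : List (Fin n)) :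
    (Fin n → ℤ) ≃ₗ[ℤ] (Fin n → ℤ) :=
  ((S.reverse).map (sigmaE A hA)).prod

/-- The symmetric generalized Cartan matrix of the underlying graph of `(Γ, Λ)`. -/
def cartanOf (Λ : Fin n → Fin n → ℕ) : Fin n → Fin n → ℤ :=
  fun i j => if i = j then 2 else -(edges Λ i j : ℤ)

theorem cartan_diag (Λ : Fin n → Fin n → ℕ) : ∀ i, cartanOf Λ i i = 2 := by
  intro i; simp [cartanOf]

/-- The simple reflections of the Weyl group of the underlying graph of `(Γ, Λ)`. -/
def wSig (Λ : Fin n → Fin n → ℕ) : Fin n → ((Fin n → ℤ) ≃ₗ[ℤ] (Fin n → ℤ)) :=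
  sigmaE (cartanOf Λ) (cartan_diag Λ)

/-- `w(S)` for a sequence of vertices of `(Γ, Λ)`. -/
def wordOfSeq (Λ : Fin n → Fin n → ℕ) (S : List (Fin n)) :
    (Fin n → ℤ) ≃ₗ[ℤ] (Fin n → ℤ) :=
  ((S.reverse).map (wSig Λ)).prod

/-- The word `w(S)` is reduced: `ℓ(w(S))` equals the number of letters of `S`. -/
noncomputable def IsReducedSeq (Λ : Fin n → Fin n → ℕ) (S : List (Fin n)) : Prop :=
  wordLen (cartanOf Λ) (cartan_diag Λ) (wordOfSeq Λ S) = S.length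

/-! ## Dynkin graphs of types A, D, E -/

def edgeA (n : ℕ) : Fin n → Fin n → ℕ := fun i j =>
  if (i : ℕ) + 1 = (j : ℕ) ∨ (j : ℕ) + 1 = (i : ℕ) then 1 else 0

def edgeD (n : ℕ) : Fin n → Fin n → ℕ := fun i j =>
  if ((i : ℕ) = 0 ∧ (j : ℕ) = 2) ∨ ((j : ℕ) = 0 ∧ (i : ℕ) = 2) ∨
     ((i : ℕ) = 1 ∧ (j : ℕ) = 2) ∨ ((j : ℕ) = 1 ∧ (i : ℕ) = 2) ∨
     (2 ≤ (i : ℕ) ∧ (i : ℕ) + 1 = (j : ℕ)) ∨ (2 ≤ (j : ℕ) ∧ (j : ℕ) + 1 = (i : ℕ))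
  then 1 else 0

def edgeE (n : ℕ) : Fin n → Fin n → ℕ := fun i j =>
  if ((i : ℕ) + 1 = (j : ℕ) ∧ (j : ℕ) ≤ n - 2) ∨ ((j : ℕ) + 1 = (i : ℕ) ∧ (i : ℕ) ≤ n - 2) ∨
     ((i : ℕ) = 2 ∧ (j : ℕ) = n - 1) ∨ ((j : ℕ) = 2 ∧ (i : ℕ) = n - 1)
  then 1 else 0

/-- The underlying graph (given by its edge-count function `E`) is a Dynkin diagram of
type `A`, `D`, or `E`. -/
def IsDynkinADE (n : ℕ) (E : Fin n → Fin n → ℕ) : Prop :=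
  ∃ e : Fin n ≃ Fin n,
    (∀ i j, E i j = edgeA n (e i) (e j)) ∨
    (4 ≤ n ∧ ∀ i j, E i j = edgeD n (e i) (e j)) ∨
    ((n = 6 ∨ n = 7 ∨ n = 8) ∧ ∀ i j, E i j = edgeE n (e i) (e j))

/-! ## Coxeter-sortable elements -/

/-- Lexicographic comparison of index tuples. -/
def lexLE {s : ℕ} (ι ι' : Fin s → ℕ) : Prop :=
  ι = ι' ∨ ∃ j, (∀ j', j' < j → ι j' = ι' j') ∧ ι j < ι' j

/-- `w` is `c`-sortable for the Coxeter element determined by the half-infinite word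
`cseq` (with dividers every `blockLen` letters): the lexicographically first subsequence
of `cseq` that is a reduced word for `w` defines a sequence of subsets (between adjacent
dividers) that is decreasing under inclusion. -/
def CSortable (A : Fin n → Fin n → ℤ) (hA : ∀ i, A i i = 2) (cseq : ℕ → Fin n)
    (blockLen : ℕ) (w : (Fin n → ℤ) ≃ₗ[ℤ] (Fin n → ℤ)) : Prop :=
  ∃ (s : ℕ) (ι : Fin s → ℕ), StrictMono ι ∧
    w = ((List.ofFn fun j => cseq (ι j)).map (sigmaE A hA)).prod ∧
    wordLen A hA w = s ∧
    (∀ ι' : Fin s → ℕ, StrictMono ι' →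
      w = ((List.ofFn fun j => cseq (ι' j)).map (sigmaE A hA)).prod → lexLE ι ι') ∧
    ∀ m : ℕ, {a : Fin n | ∃ j, (ι j) / blockLen = m + 1 ∧ cseq (ι j) = a} ⊆
             {a : Fin n | ∃ j, (ι j) / blockLen = m ∧ cseq (ι j) = a}


/-- A nonzero non-isomorphism between representations. -/
def RepStep {k : Type} [Field k] {n : ℕ} {Λ : Fin n → Fin n → ℕ} (X Y : Rep k n Λ) : Prop :=
  ∃ f : RepHom X Y, (∃ x v, f.g x v ≠ 0) ∧ ¬ ∀ x, Function.Bijective (f.g x)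

/-- `v` is a minimal element of `D` in the poset `(Γ₀, Λ)`. -/
def MinimalIn {n : ℕ} (Λ : Fin n → Fin n → ℕ) (D : Set (Fin n)) (v : Fin n) : Prop :=
  v ∈ D ∧ ∀ u ∈ D, PathLE Λ u v → u = v

/-- The pairs `(h, v)` of Proposition 3.2(a): `0 < h ≤ r` and `v` a minimal element of
`Supp S_h \ H_Λ(Supp S_{h+1})` (with `Supp S_{r+1} = ∅`). -/
def JoinPair {n : ℕ} (Λ : Fin n → Fin n → ℕ) (segs : List (List (Fin n)))
    (p : ℕ × Fin n) : Prop :=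
  0 < p.1 ∧ p.1 ≤ segs.length ∧
  MinimalIn Λ (suppOf (segs.getD (p.1 - 1) []) \ hull Λ (suppOf (segs.getD p.1 []))) p.2

/-! ## Numerical preliminaries: the Euler form and reflections -/

/-- The Euler form of `(Γ, Λ)`. -/
def eul {n : ℕ} (Λ : Fin n → Fin n → ℕ) (p d : Fin n → ℤ) : ℤ :=
  ∑ a, p a * d a - ∑ a, ∑ b, (Λ a b : ℤ) * p a * d b

theorem edges_flip {n : ℕ} (x : Fin n) (Λ : Fin n → Fin n → ℕ) (a b : Fin n) :
    edges (flipO x Λ) a b = edges Λ a b := by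
  unfold edges flipO
  by_cases h : a = x ∨ b = x
  · have h' : b = x ∨ a = x := h.symm
    simp only [h, h', if_true]; omega
  · have h' : ¬ (b = x ∨ a = x) := fun q => h q.symm
    simp only [h, h', if_false]

theorem edges_symm {n : ℕ} (Λ : Fin n → Fin n → ℕ) (a b : Fin n) :
    edges Λ a b = edges Λ b a := by
  unfold edges; omega

theorem cartan_flip {n : ℕ} (x : Fin n) (Λ : Fin n → Fin n → ℕ) :
    cartanOf (flipO x Λ) = cartanOf Λ := by
  funext a b
  simp only [cartanOf, edges_flip]

theorem loop_flip {n : ℕ} {x : Fin n} {Λ : Fin n → Fin n → ℕ} (h : ∀ a, Λ a a = 0) :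
    ∀ a, flipO x Λ a a = 0 := by
  intro a; unfold flipO; split <;> exact h a

theorem sigma_apply {n : ℕ} (A : Fin n → Fin n → ℤ) (x : Fin n) (v : Fin n → ℤ) (z : Fin n) :
    sigmaL A x v z = v z - if z = x then ∑ l, A x l * v l else 0 := by
  simp only [sigmaL, LinearMap.coe_mk, AddHom.coe_mk, Pi.sub_apply, Pi.smul_apply, smul_eq_mul,
    Pi.single_apply]
  split <;> simp

theorem sigma_form {n : ℕ} (A : Fin n → Fin n → ℤ) (x : Fin n) (v : Fin n → ℤ) :
    sigmaL A x v = v - (∑ l, A x l * v l) • Pi.single x 1 := rfl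

theorem sigma_sigma {n : ℕ} (Λ : Fin n → Fin n → ℕ) (x : Fin n) (v : Fin n → ℤ) :
    sigmaL (cartanOf Λ) x (sigmaL (cartanOf Λ) x v) = v :=
  LinearMap.congr_fun (sigma_invol (cartanOf Λ) (cartan_diag Λ) x) v

theorem cartan_sum {n : ℕ} (Λ : Fin n → Fin n → ℕ) (hl : ∀ a, Λ a a = 0) (x : Fin n)
    (v : Fin n → ℤ) :
    ∑ l, cartanOf Λ x l * v l = 2 * v x - ∑ l, (edges Λ x l : ℤ) * v l := by
  have : ∀ l, cartanOf Λ x l * v l =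
      (if l = x then 2 * v x else 0) - (edges Λ x l : ℤ) * v l := by
    intro l
    unfold cartanOf
    by_cases h : x = l
    · subst h; simp [edges, hl]
    · have h' : ¬ l = x := fun q => h q.symm
      simp [h, h']
  simp only [this, Finset.sum_sub_distrib]
  simp

theorem cartan_sum_sink {n : ℕ} (Λ : Fin n → Fin n → ℕ) (hl : ∀ a, Λ a a = 0) (x : Fin n)
    (hx : IsSink Λ x) (v : Fin n → ℤ) :
    ∑ l, cartanOf Λ x l * v l = 2 * v x - ∑ l, (Λ l x : ℤ) * v l := by
  rw [cartan_sum Λ hl]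
  congr 1
  apply Finset.sum_congr rfl
  intro l _
  simp [edges, hx l]

theorem eul_add_right {n : ℕ} (Λ : Fin n → Fin n → ℕ) (p d e : Fin n → ℤ) :
    eul Λ p (d + e) = eul Λ p d + eul Λ p e := by
  simp only [eul, Pi.add_apply, mul_add, Finset.sum_add_distrib]; ring

theorem eul_smul_right {n : ℕ} (Λ : Fin n → Fin n → ℕ) (p d : Fin n → ℤ) (c : ℤ) :
    eul Λ p (c • d) = c * eul Λ p d := by
  simp only [eul, Pi.smul_apply, smul_eq_mul, mul_sub, Finset.mul_sum]
  congr 1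
  · exact Finset.sum_congr rfl fun a _ => by ring
  · exact Finset.sum_congr rfl fun a _ => Finset.sum_congr rfl fun b _ => by ring

theorem eul_add_left {n : ℕ} (Λ : Fin n → Fin n → ℕ) (p q d : Fin n → ℤ) :
    eul Λ (p + q) d = eul Λ p d + eul Λ q d := by
  simp only [eul, Pi.add_apply, add_mul, mul_add, Finset.sum_add_distrib]; ring

theorem eul_smul_left {n : ℕ} (Λ : Fin n → Fin n → ℕ) (p d : Fin n → ℤ) (c : ℤ) :
    eul Λ (c • p) d = c * eul Λ p d := by
  simp only [eul, Pi.smul_apply, smul_eq_mul, mul_sub, Finset.mul_sum]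
  congr 1
  · exact Finset.sum_congr rfl fun a _ => by ring
  · exact Finset.sum_congr rfl fun a _ => Finset.sum_congr rfl fun b _ => by ring

theorem eul_single_right {n : ℕ} (Λ : Fin n → Fin n → ℕ) (p : Fin n → ℤ) (x : Fin n) :
    eul Λ p (Pi.single x 1) = p x - ∑ a, (Λ a x : ℤ) * p a := by
  simp [eul, Pi.single_apply]

theorem eul_single_left {n : ℕ} (Λ : Fin n → Fin n → ℕ) (d : Fin n → ℤ) (x : Fin n) :
    eul Λ (Pi.single x 1) d = d x - ∑ b, (Λ x b : ℤ) * d b := by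
  unfold eul
  congr 1
  · simp [Pi.single_apply]
  · rw [Finset.sum_eq_single x]
    · simp
    · intro a _ ha; simp [Pi.single_eq_of_ne ha]
    · simp

theorem eul_sink_left {n : ℕ} (Λ : Fin n → Fin n → ℕ) (d : Fin n → ℤ) (x : Fin n)
    (hx : IsSink Λ x) : eul Λ (Pi.single x 1) d = d x := by
  rw [eul_single_left]; simp [hx _]

theorem flip_into {n : ℕ} {Λ : Fin n → Fin n → ℕ} {x : Fin n} (hx : IsSink Λ x) (a : Fin n) :
    flipO x Λ a x = 0 := by
  simp [flipO, hx a]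

theorem eul_source_right {n : ℕ} (Λ : Fin n → Fin n → ℕ) (p : Fin n → ℤ) (x : Fin n)
    (hx : IsSink Λ x) : eul (flipO x Λ) p (Pi.single x 1) = p x := by
  rw [eul_single_right]; simp [flip_into hx]

theorem eul_flip {n : ℕ} (Λ : Fin n → Fin n → ℕ) (hl : ∀ a, Λ a a = 0) (x : Fin n)
    (hx : IsSink Λ x) (p d : Fin n → ℤ) :
    eul (flipO x Λ) p d = eul Λ p d + (∑ y, (Λ y x : ℤ) * p y) * d x
      - p x * ∑ y, (Λ y x : ℤ) * d y := by
  have key : ∀ a b, (flipO x Λ a b : ℤ) * p a * d b = (Λ a b : ℤ) * p a * d b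
      - (if b = x then (Λ a x : ℤ) * p a * d x else 0)
      + (if a = x then (Λ b x : ℤ) * p x * d b else 0) := by
    intro a b
    unfold flipO
    by_cases ha : a = x
    · subst ha
      by_cases hb : b = a
      · subst hb; simp [hl]
      · simp [hb, hx b]
    · by_cases hb : b = x
      · subst hb; simp [ha, hx a]
      · simp [ha, hb]
  have h1 : ∑ a, ∑ b, (flipO x Λ a b : ℤ) * p a * d b
      = ∑ a, ∑ b, (Λ a b : ℤ) * p a * d b - (∑ y, (Λ y x : ℤ) * p y) * d x
        + p x * ∑ y, (Λ y x : ℤ) * d y := by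
    simp only [key, Finset.sum_add_distrib, Finset.sum_sub_distrib]
    congr 1
    · congr 1
      simp [Finset.sum_mul]
    · rw [Finset.sum_comm]
      simp only [Finset.sum_ite_eq', Finset.mem_univ, if_true, Finset.mul_sum]
      exact Finset.sum_congr rfl fun b _ => by ring
  unfold eul at *
  rw [h1]; ring

theorem eul_refl {n : ℕ} (Λ : Fin n → Fin n → ℕ) (hl : ∀ a, Λ a a = 0) (x : Fin n)
    (hx : IsSink Λ x) (p d : Fin n → ℤ) :
    eul (flipO x Λ) p (sigmaL (cartanOf Λ) x d) = eul Λ (sigmaL (cartanOf Λ) x p) d := by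
  rw [sigma_form, sigma_form, sub_eq_add_neg, sub_eq_add_neg, ← neg_smul, ← neg_smul,
    eul_add_right, eul_add_left, eul_smul_right, eul_smul_left, eul_source_right _ _ _ hx,
    eul_sink_left _ _ _ hx, eul_flip Λ hl x hx, cartan_sum_sink Λ hl x hx,
    cartan_sum_sink Λ hl x hx]
  ring

/-- `σ_{x_1} ⋯ σ_{x_s} p`. -/
def back {n : ℕ} (A : Fin n → Fin n → ℤ) : List (Fin n) → (Fin n → ℤ) → (Fin n → ℤ)
  | [], p => p
  | x :: S, p => sigmaL A x (back A S p)

/-- `σ_{x_s} ⋯ σ_{x_1} p`. -/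
def fwd {n : ℕ} (A : Fin n → Fin n → ℤ) : List (Fin n) → (Fin n → ℤ) → (Fin n → ℤ)
  | [], p => p
  | x :: S, p => fwd A S (sigmaL A x p)

/-- `∑ m_j σ_{x_1} ⋯ σ_{x_{j-1}} e_{x_j}`. -/
def vec {n : ℕ} (A : Fin n → Fin n → ℤ) : List (Fin n × ℕ) → (Fin n → ℤ)
  | [] => 0
  | (x, m) :: l => sigmaL A x (vec A l) + (m : ℤ) • Pi.single x 1

theorem eul_fwd {n : ℕ} (S : List (Fin n)) : ∀ (Λ : Fin n → Fin n → ℕ) (_ : ∀ a, Λ a a = 0)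
    (_ : Admissible Λ S) (p d : Fin n → ℤ),
    eul (orientAfter Λ S) p (fwd (cartanOf Λ) S d) = eul Λ (back (cartanOf Λ) S p) d := by
  induction S with
  | nil => intros; rfl
  | cons x S ih =>
    intro Λ hl hS p d
    have h := ih (flipO x Λ) (loop_flip hl) hS.2 p (sigmaL (cartanOf Λ) x d)
    rw [cartan_flip] at h
    simp only [orientAfter, fwd, back]
    rw [h, eul_refl Λ hl x hS.1]

theorem back_append {n : ℕ} (A : Fin n → Fin n → ℤ) (S T : List (Fin n)) (p : Fin n → ℤ) :
    back A (S ++ T) p = back A S (back A T p) := by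
  induction S with
  | nil => rfl
  | cons x S ih => simp only [List.cons_append, back, ih]

theorem back_neg {n : ℕ} (A : Fin n → Fin n → ℤ) (S : List (Fin n)) (p : Fin n → ℤ) :
    back A S (-p) = - back A S p := by
  induction S with
  | nil => rfl
  | cons x S ih => simp only [back, ih, map_neg]

theorem fwd_neg {n : ℕ} (A : Fin n → Fin n → ℤ) (S : List (Fin n)) : ∀ (p : Fin n → ℤ),
    fwd A S (-p) = - fwd A S p := by
  induction S with
  | nil => intro p; rfl
  | cons x S ih => intro p; simp only [fwd, ih, map_neg]

theorem fwd_add {n : ℕ} (A : Fin n → Fin n → ℤ) (S : List (Fin n)) : ∀ (p q : Fin n → ℤ),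
    fwd A S (p + q) = fwd A S p + fwd A S q := by
  induction S with
  | nil => intro p q; rfl
  | cons x S ih => intro p q; simp only [fwd, ih, map_add]

theorem sigma_single_self {n : ℕ} (Λ : Fin n → Fin n → ℕ) (x : Fin n) :
    sigmaL (cartanOf Λ) x (Pi.single x 1) = - Pi.single x 1 := by
  rw [sigma_form]
  have : ∑ l, cartanOf Λ x l * (Pi.single x 1 : Fin n → ℤ) l = 2 := by
    simp [Pi.single_apply, cartan_diag]
  rw [this, two_smul]; abel

theorem sigma_single_ne {n : ℕ} (Λ : Fin n → Fin n → ℕ) (x y : Fin n) (h : x ≠ y) :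
    sigmaL (cartanOf Λ) x (Pi.single y 1) = Pi.single y 1 + (edges Λ x y : ℤ) • Pi.single x 1 := by
  rw [sigma_form]
  have : ∑ l, cartanOf Λ x l * (Pi.single y 1 : Fin n → ℤ) l = - (edges Λ x y : ℤ) := by
    simp [Pi.single_apply, cartanOf, h]
  rw [this, neg_smul, sub_neg_eq_add]

theorem sigma_comm {n : ℕ} (Λ : Fin n → Fin n → ℕ) (x y : Fin n) (h : edges Λ x y = 0)
    (v : Fin n → ℤ) :
    sigmaL (cartanOf Λ) x (sigmaL (cartanOf Λ) y v) =
      sigmaL (cartanOf Λ) y (sigmaL (cartanOf Λ) x v) := by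
  by_cases hxy : x = y
  · subst hxy; rfl
  have h' : edges Λ y x = 0 := by rw [edges_symm]; exact h
  conv_lhs => rw [sigma_form _ y, map_sub, map_smul, sigma_single_ne Λ x y hxy, h]
  conv_rhs => rw [sigma_form _ x, map_sub, map_smul, sigma_single_ne Λ y x (Ne.symm hxy), h']
  rw [sigma_form _ x, sigma_form _ y]
  simp only [Nat.cast_zero, zero_smul, add_zero]
  abel

theorem back_sim {n : ℕ} (Λ : Fin n → Fin n → ℕ) {S T : List (Fin n)} (h : Sim (edges Λ) S T)
    (p : Fin n → ℤ) : back (cartanOf Λ) S p = back (cartanOf Λ) T p := by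
  induction h with
  | refl => rfl
  | tail _ hs ih =>
    rw [ih]
    cases hs with
    | swap l₁ l₂ a b h =>
      rw [back_append, back_append]
      simp only [back]
      rw [sigma_comm Λ a b h]

theorem admissible_append {n : ℕ} (S : List (Fin n)) : ∀ (Λ : Fin n → Fin n → ℕ)
    (T : List (Fin n)), Admissible Λ (S ++ T) ↔
      Admissible Λ S ∧ Admissible (orientAfter Λ S) T := by
  induction S with
  | nil => intro Λ T; simp [Admissible, orientAfter]
  | cons x S ih =>
    intro Λ T
    simp only [List.cons_append, Admissible, orientAfter, ih, and_assoc]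

theorem orient_append {n : ℕ} (S : List (Fin n)) : ∀ (Λ : Fin n → Fin n → ℕ)
    (T : List (Fin n)), orientAfter Λ (S ++ T) = orientAfter (orientAfter Λ S) T := by
  induction S with
  | nil => intro Λ T; rfl
  | cons x S ih => intro Λ T; simp only [List.cons_append, orientAfter, ih]

theorem edges_orient {n : ℕ} (S : List (Fin n)) : ∀ (Λ : Fin n → Fin n → ℕ) (a b : Fin n),
    edges (orientAfter Λ S) a b = edges Λ a b := by
  induction S with
  | nil => intro Λ a b; rfl
  | cons x S ih => intro Λ a b; simp only [orientAfter, ih, edges_flip]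

theorem sim_symm {n : ℕ} (Λ : Fin n → Fin n → ℕ) {S T : List (Fin n)} (h : Sim (edges Λ) S T) :
    Sim (edges Λ) T S := by
  induction h with
  | refl => exact Relation.ReflTransGen.refl
  | tail _ hs ih =>
    refine Relation.ReflTransGen.head ?_ ih
    cases hs with
    | swap l₁ l₂ a b h => exact SwapRel.swap l₁ l₂ b a (by rw [edges_symm]; exact h)

/-- `back` applied to a vector with nonpositive pairings, as a combination of roots. -/
theorem back_eq_vec {n : ℕ} (Λ : Fin n → Fin n → ℕ) (z : Fin n → ℤ)
    (hz : ∀ x, ∑ l, cartanOf Λ x l * z l ≤ 0) (S : List (Fin n)) :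
    back (cartanOf Λ) S z =
      z + vec (cartanOf Λ) (S.map fun x => (x, (- ∑ l, cartanOf Λ x l * z l).toNat)) := by
  induction S with
  | nil => simp [back, vec]
  | cons x S ih =>
    simp only [back, List.map_cons, vec]
    rw [ih, map_add, sigma_form _ x z]
    have : (((- ∑ l, cartanOf Λ x l * z l).toNat : ℕ) : ℤ) = - ∑ l, cartanOf Λ x l * z l :=
      Int.toNat_of_nonneg (by have := hz x; omega)
    rw [this, neg_smul]
    abel

/-- roots as values of `vec`. -/
theorem back_single_eq_vec {n : ℕ} (Λ : Fin n → Fin n → ℕ) (S : List (Fin n)) (y : Fin n) :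
    back (cartanOf Λ) S (Pi.single y 1) =
      vec (cartanOf Λ) ((S.map fun x => (x, 0)) ++ [(y, 1)]) := by
  induction S with
  | nil => simp [back, vec]
  | cons x S ih =>
    simp only [back, List.map_cons, List.cons_append, vec]
    rw [ih]; simp

/-! ## Representations -/

/-- Dimension vector. -/
def dimv {k : Type} [Field k] {n : ℕ} {Λ : Fin n → Fin n → ℕ} (M : Rep k n Λ) : Fin n → ℤ :=
  fun z => (M.d z : ℤ)

theorem finrank_arin {k : Type} [Field k] {n : ℕ} (Λ : Fin n → Fin n → ℕ) (d : Fin n → ℕ)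
    (x : Fin n) :
    Module.finrank k ((p : Arin Λ x) → (Fin (d p.1) → k)) = ∑ y, Λ y x * d y := by
  rw [Module.finrank_pi_fintype]
  simp only [Module.finrank_fin_fun]
  rw [Fintype.sum_sigma]
  simp

theorem finrank_aout {k : Type} [Field k] {n : ℕ} (Λ : Fin n → Fin n → ℕ) (d : Fin n → ℕ)
    (x : Fin n) :
    Module.finrank k ((p : Aout Λ x) → (Fin (d p.1) → k)) = ∑ y, Λ x y * d y := by
  rw [Module.finrank_pi_fintype]
  simp only [Module.finrank_fin_fun]
  rw [Fintype.sum_sigma]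
  simp

theorem dim_refl_ne {k : Type} [Field k] {n : ℕ} (Λ : Fin n → Fin n → ℕ) (M : Rep k n Λ)
    {x z : Fin n} (h : z ≠ x) : (reflPlus x Λ M).d z = M.d z := if_neg h

theorem dim_refl_self {k : Type} [Field k] {n : ℕ} (Λ : Fin n → Fin n → ℕ) (M : Rep k n Λ)
    (x : Fin n) : (reflPlus x Λ M).d x = Module.finrank k (LinearMap.ker (inMap Λ M x)) :=
  if_pos rfl

theorem dim_refl_ge {k : Type} [Field k] {n : ℕ} (Λ : Fin n → Fin n → ℕ) (M : Rep k n Λ)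
    (x : Fin n) : ∑ y, Λ y x * M.d y ≤ (reflPlus x Λ M).d x + M.d x := by
  rw [dim_refl_self]
  have h1 := LinearMap.finrank_range_add_finrank_ker (inMap Λ M x)
  have h2 := Submodule.finrank_le (LinearMap.range (inMap Λ M x))
  rw [Module.finrank_fin_fun] at h2
  rw [finrank_arin Λ M.d x] at h1
  omega

theorem zero_refl {k : Type} [Field k] {n : ℕ} (Λ : Fin n → Fin n → ℕ) (M : Rep k n Λ)
    (x : Fin n) (h : IsZeroRep M) : IsZeroRep (reflPlus x Λ M) := by
  intro z
  by_cases hz : z = x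
  · subst hz
    rw [dim_refl_self]
    have h2 := Submodule.finrank_le (LinearMap.ker (inMap Λ M z))
    rw [finrank_arin Λ M.d z] at h2
    have : ∑ y, Λ y z * M.d y = 0 := by simp [h _]
    omega
  · rw [dim_refl_ne _ _ hz]; exact h z

theorem zero_FList {k : Type} [Field k] {n : ℕ} (S : List (Fin n)) :
    ∀ (Λ : Fin n → Fin n → ℕ) (M : Rep k n Λ), IsZeroRep M → IsZeroRep (FList S Λ M) := by
  induction S with
  | nil => intro Λ M h; exact h
  | cons x S ih => intro Λ M h; exact ih _ _ (zero_refl Λ M x h)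

theorem annihilates_append {k : Type} [Field k] {n : ℕ} (S T : List (Fin n)) :
    ∀ (Λ : Fin n → Fin n → ℕ) (M : Rep k n Λ), Annihilates Λ S M → Annihilates Λ (S ++ T) M := by
  induction S with
  | nil => intro Λ M h; exact zero_FList T Λ M h
  | cons x S ih => intro Λ M h; exact ih _ _ h

/-- One step of the fundamental dimension estimate. -/
theorem eul_step {k : Type} [Field k] {n : ℕ} (Λ : Fin n → Fin n → ℕ) (hl : ∀ a, Λ a a = 0)
    (x : Fin n) (hx : IsSink Λ x) (M : Rep k n Λ) (p : Fin n → ℤ) (hp : 0 ≤ p x) :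
    eul Λ (sigmaL (cartanOf Λ) x p) (dimv M) ≤ eul (flipO x Λ) p (dimv (reflPlus x Λ M)) := by
  have h := dim_refl_ge Λ M x
  obtain ⟨r, hr⟩ := Nat.exists_eq_add_of_le h
  have : dimv (reflPlus x Λ M) = sigmaL (cartanOf Λ) x (dimv M) + (r : ℤ) • Pi.single x 1 := by
    funext z
    rw [sigma_form, cartan_sum_sink Λ hl x hx]
    by_cases hz : z = x
    · subst hz
      have hr' : (((reflPlus z Λ M).d z + M.d z : ℕ) : ℤ) = ((∑ y, Λ y z * M.d y + r : ℕ) : ℤ) :=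
        congrArg _ hr
      push_cast at hr'
      simp [dimv]
      linarith
    · simp [dimv, dim_refl_ne _ _ hz, Pi.single_eq_of_ne hz]
  rw [this, eul_add_right, eul_smul_right, eul_refl Λ hl x hx, eul_source_right _ _ _ hx]
  have : 0 ≤ (r : ℤ) * p x := by positivity
  linarith

theorem eul_lower {k : Type} [Field k] {n : ℕ} (S : List (Fin n)) :
    ∀ (Λ : Fin n → Fin n → ℕ) (_ : ∀ a, Λ a a = 0) (_ : Admissible Λ S) (M : Rep k n Λ)
      (p : Fin n → ℤ) (_ : ∀ T, T <:+ S → ∀ i, 0 ≤ back (cartanOf Λ) T p i),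
      eul Λ (back (cartanOf Λ) S p) (dimv M) ≤ eul (orientAfter Λ S) p (dimv (FList S Λ M)) := by
  induction S with
  | nil => intro Λ hl hS M p hp; exact le_refl _
  | cons x S ih =>
    intro Λ hl hS M p hp
    have h := ih (flipO x Λ) (loop_flip hl) hS.2 (reflPlus x Λ M) p (by
      rw [cartan_flip]
      exact fun T hT => hp T (hT.trans (List.suffix_cons x S)))
    rw [cartan_flip] at h
    exact (eul_step Λ hl x hS.1 M _ (hp S (List.suffix_cons x S) x)).trans h

/-! ### Embeddings -/

/-- There is a monomorphism `M → N`. -/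
def Emb {k : Type} [Field k] {n : ℕ} {Λ : Fin n → Fin n → ℕ} (M N : Rep k n Λ) : Prop :=
  ∃ h : RepHom M N, ∀ x, Function.Injective (h.g x)

theorem Emb.zero {k : Type} [Field k] {n : ℕ} {Λ : Fin n → Fin n → ℕ} {M N : Rep k n Λ}
    (h : Emb M N) (hN : IsZeroRep N) : IsZeroRep M := by
  obtain ⟨g, hg⟩ := h
  intro x
  have := LinearMap.finrank_le_finrank_of_injective (hg x)
  rw [Module.finrank_fin_fun, Module.finrank_fin_fun, hN x] at this
  omega

/-- The space of `F_x⁺ M` at `x`. -/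
noncomputable def eX {k : Type} [Field k] {n : ℕ} (Λ : Fin n → Fin n → ℕ) (M : Rep k n Λ)
    (x : Fin n) : (Fin ((reflPlus x Λ M).d x) → k) ≃ₗ[k] LinearMap.ker (inMap Λ M x) :=
  (castL k (dim_refl_self Λ M x)).trans (kerEquiv Λ M x).symm

/-- The space of `F_x⁺ M` at `z ≠ x`. -/
noncomputable def eZ {k : Type} [Field k] {n : ℕ} (Λ : Fin n → Fin n → ℕ) (M : Rep k n Λ)
    (x : Fin n) {z : Fin n} (h : z ≠ x) :
    (Fin ((reflPlus x Λ M).d z) → k) ≃ₗ[k] (Fin (M.d z) → k) :=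
  castL k (dim_refl_ne Λ M h)

theorem flip_from {n : ℕ} (Λ : Fin n → Fin n → ℕ) (x b : Fin n) : flipO x Λ x b = Λ b x := by
  simp [flipO]

theorem flip_ne {n : ℕ} (Λ : Fin n → Fin n → ℕ) {x a b : Fin n} (ha : a ≠ x) (hb : b ≠ x) :
    flipO x Λ a b = Λ a b := by
  simp [flipO, ha, hb]

theorem castL_castL {k : Type} [Field k] {m m' : ℕ} (h : m = m') (h' : m' = m)
    (v : Fin m → k) : castL k h' (castL k h v) = v := by
  subst h; rfl

theorem eZ_from {k : Type} [Field k] {n : ℕ} (Λ : Fin n → Fin n → ℕ) (M : Rep k n Λ)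
    (x : Fin n) {b : Fin n} (h : b ≠ x) (i : Fin (flipO x Λ x b)) (v) :
    eZ Λ M x h ((reflPlus x Λ M).f x b i v) =
      (eX Λ M x v).1 ⟨b, Fin.cast (flip_from Λ x b) i⟩ := by
  simp only [reflPlus, dif_pos, dif_neg h]
  exact castL_castL (dim_refl_ne Λ M h).symm (dim_refl_ne Λ M h) _

theorem eZ_ne {k : Type} [Field k] {n : ℕ} (Λ : Fin n → Fin n → ℕ) (M : Rep k n Λ)
    (x : Fin n) {a b : Fin n} (ha : a ≠ x) (hb : b ≠ x) (i : Fin (flipO x Λ a b)) (v) :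
    eZ Λ M x hb ((reflPlus x Λ M).f a b i v) =
      M.f a b (Fin.cast (flip_ne Λ ha hb) i) (eZ Λ M x ha v) := by
  simp only [reflPlus, dif_neg ha, dif_neg hb]
  exact castL_castL (dim_refl_ne Λ M hb).symm (dim_refl_ne Λ M hb) _

/-- A general way to produce an embedding out of `F_x⁺ M`. -/
theorem emb_of_refl {k : Type} [Field k] {n : ℕ} (Λ : Fin n → Fin n → ℕ) (x : Fin n)
    (hx : IsSink Λ x) (M : Rep k n Λ) (N : Rep k n (flipO x Λ))
    (gx : LinearMap.ker (inMap Λ M x) →ₗ[k] (Fin (N.d x) → k))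
    (gz : ∀ z, z ≠ x → ((Fin (M.d z) → k) →ₗ[k] (Fin (N.d z) → k)))
    (hgx : Function.Injective gx) (hgz : ∀ z h, Function.Injective (gz z h))
    (h1 : ∀ b (hb : b ≠ x) (i : Fin (flipO x Λ x b)) v,
      N.f x b i (gx v) = gz b hb (v.1 ⟨b, Fin.cast (flip_from Λ x b) i⟩))
    (h2 : ∀ a b (ha : a ≠ x) (hb : b ≠ x) (i : Fin (flipO x Λ a b)) v,
      N.f a b i (gz a ha v) = gz b hb (M.f a b (Fin.cast (flip_ne Λ ha hb) i) v)) :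
    Emb (reflPlus x Λ M) N := by
  let G : ∀ z, (Fin ((reflPlus x Λ M).d z) → k) →ₗ[k] (Fin (N.d z) → k) := fun z =>
    if h : z = x then
      (castL k (congrArg N.d h.symm)).toLinearMap ∘ₗ gx ∘ₗ (eX Λ M x).toLinearMap ∘ₗ
        (castL k (congrArg (reflPlus x Λ M).d h)).toLinearMap
    else gz z h ∘ₗ (eZ Λ M x h).toLinearMap
  have Gx : ∀ v, G x v = gx (eX Λ M x v) := by
    intro v; simp only [G, dif_pos]; rfl
  have Gz : ∀ z (h : z ≠ x) v, G z v = gz z h (eZ Λ M x h v) := by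
    intro z h v; simp [G, h]
  refine ⟨⟨G, ?_⟩, ?_⟩
  · intro a b i v
    by_cases hb : b = x
    · subst hb
      exact absurd i.2 (by have := flip_into hx a; omega)
    · by_cases ha : a = x
      · subst ha
        rw [Gz b hb, eZ_from, Gx, h1 b hb]
      · rw [Gz b hb, Gz a ha, eZ_ne Λ M x ha hb, h2 a b ha hb]
  · intro z
    by_cases h : z = x
    · subst h
      intro u v huv
      simp only [Gx] at huv
      exact (eX Λ M z).injective (hgx huv)
    · intro u v huv
      simp only [Gz z h] at huv
      exact (eZ Λ M x h).injective (hgz z h huv)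

theorem inMap_apply {k : Type} [Field k] {n : ℕ} (Λ : Fin n → Fin n → ℕ) (M : Rep k n Λ)
    (x : Fin n) (v : (p : Arin Λ x) → (Fin (M.d p.1) → k)) :
    inMap Λ M x v = ∑ p : Arin Λ x, M.f p.1 x p.2 (v p) := by
  simp [inMap]


theorem emb_refl {k : Type} [Field k] {n : ℕ} (Λ : Fin n → Fin n → ℕ) (x : Fin n)
    (hx : IsSink Λ x) (M N : Rep k n Λ) (h : Emb M N) :
    Emb (reflPlus x Λ M) (reflPlus x Λ N) := by
  obtain ⟨g, hg⟩ := h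
  let P : ((p : Arin Λ x) → (Fin (M.d p.1) → k)) →ₗ[k] ((p : Arin Λ x) → (Fin (N.d p.1) → k)) :=
    LinearMap.pi fun p => g.g p.1 ∘ₗ LinearMap.proj p
  have hP : ∀ v p, P v p = g.g p.1 (v p) := fun v p => rfl
  have hcomm : ∀ v, inMap Λ N x (P v) = g.g x (inMap Λ M x v) := by
    intro v
    rw [inMap_apply, inMap_apply, map_sum]
    exact Finset.sum_congr rfl fun p _ => by rw [hP, g.comm]
  have hker : ∀ v ∈ LinearMap.ker (inMap Λ M x), P v ∈ LinearMap.ker (inMap Λ N x) := by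
    intro v hv
    rw [LinearMap.mem_ker] at hv ⊢
    rw [hcomm, hv, map_zero]
  apply emb_of_refl Λ x hx M (reflPlus x Λ N)
    ((eX Λ N x).symm.toLinearMap ∘ₗ P.restrict hker)
    (fun z hz => (eZ Λ N x hz).symm.toLinearMap ∘ₗ g.g z)
  · intro u v huv
    have h1 := (eX Λ N x).symm.injective huv
    have h2 : P u.1 = P v.1 := congrArg Subtype.val h1
    apply Subtype.ext
    funext p
    exact hg p.1 (congrFun h2 p)
  · intro z hz u v huv
    exact hg z ((eZ Λ N x hz).symm.injective huv)
  · intro b hb i v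
    apply (eZ Λ N x hb).injective
    rw [eZ_from]
    simp [hP]
  · intro a b ha hb i v
    apply (eZ Λ N x hb).injective
    rw [eZ_ne Λ N x ha hb]
    simp [g.comm]

theorem emb_FList {k : Type} [Field k] {n : ℕ} (S : List (Fin n)) :
    ∀ (Λ : Fin n → Fin n → ℕ) (_ : Admissible Λ S) (M N : Rep k n Λ), Emb M N →
      Emb (FList S Λ M) (FList S Λ N) := by
  induction S with
  | nil => intro Λ _ M N h; exact h
  | cons x S ih => intro Λ hS M N h; exact ih _ hS.2 _ _ (emb_refl Λ x hS.1 M N h)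

/-! ### Going backwards -/

/-- The cokernel at `x`, enlarged by `k^m`. -/
abbrev QQ {k : Type} [Field k] {n : ℕ} (Λ : Fin n → Fin n → ℕ) (N : Rep k n Λ)
    (x : Fin n) (m : ℕ) :=
  (((p : Aout Λ x) → (Fin (N.d p.1) → k)) ⧸ LinearMap.range (outMap Λ N x)) × (Fin m → k)

/-- `F_x⁻ N ⊕ L_x^m`. -/
noncomputable def unrefl {k : Type} [Field k] {n : ℕ} (x : Fin n) (Λ : Fin n → Fin n → ℕ)
    (N : Rep k n (flipO x Λ)) (m : ℕ) : Rep k n Λ where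
  d z := if z = x then Module.finrank k (QQ (flipO x Λ) N x m) else N.d z
  f a b i :=
    if hb : b = x then
      if ha : a = x then 0
      else
        (castL k (if_pos hb).symm).toLinearMap ∘ₗ
          (Module.finBasis k (QQ (flipO x Λ) N x m)).equivFun.toLinearMap ∘ₗ
          LinearMap.inl k _ _ ∘ₗ
          (LinearMap.range (outMap (flipO x Λ) N x)).mkQ ∘ₗ
          (LinearMap.single k (fun p : Aout (flipO x Λ) x => Fin (N.d p.1) → k)
            (⟨a, Fin.cast (by subst hb; simp [flipO]) i⟩ : Aout (flipO x Λ) x)) ∘ₗ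
          (castL k (if_neg ha)).toLinearMap
    else
      if ha : a = x then 0
      else
        (castL k (if_neg hb).symm).toLinearMap ∘ₗ
          N.f a b (Fin.cast (by simp [flipO, ha, hb]) i) ∘ₗ
          (castL k (if_neg ha)).toLinearMap

theorem unrefl_d_self {k : Type} [Field k] {n : ℕ} (x : Fin n) (Λ : Fin n → Fin n → ℕ)
    (N : Rep k n (flipO x Λ)) (m : ℕ) :
    (unrefl x Λ N m).d x = Module.finrank k (QQ (flipO x Λ) N x m) := if_pos rfl

theorem unrefl_d_ne {k : Type} [Field k] {n : ℕ} (x : Fin n) (Λ : Fin n → Fin n → ℕ)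
    (N : Rep k n (flipO x Λ)) (m : ℕ) {z : Fin n} (h : z ≠ x) :
    (unrefl x Λ N m).d z = N.d z := if_neg h

theorem unrefl_f_to {k : Type} [Field k] {n : ℕ} (x : Fin n) (Λ : Fin n → Fin n → ℕ)
    (N : Rep k n (flipO x Λ)) (m : ℕ) {a : Fin n} (h : a ≠ x) (i : Fin (Λ a x)) (v) :
    (unrefl x Λ N m).f a x i v =
      castL k (unrefl_d_self x Λ N m).symm
        ((Module.finBasis k (QQ (flipO x Λ) N x m)).equivFun
          (LinearMap.inl k _ _ ((LinearMap.range (outMap (flipO x Λ) N x)).mkQ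
            (LinearMap.single k (fun p : Aout (flipO x Λ) x => Fin (N.d p.1) → k)
              (⟨a, Fin.cast (flip_from Λ x a).symm i⟩ : Aout (flipO x Λ) x)
              (castL k (unrefl_d_ne x Λ N m h) v))))) := by
  simp only [unrefl, dif_pos, dif_neg h]
  rfl

theorem unrefl_f_ne {k : Type} [Field k] {n : ℕ} (x : Fin n) (Λ : Fin n → Fin n → ℕ)
    (N : Rep k n (flipO x Λ)) (m : ℕ) {a b : Fin n} (ha : a ≠ x) (hb : b ≠ x)
    (i : Fin (Λ a b)) (v) :
    (unrefl x Λ N m).f a b i v =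
      castL k (unrefl_d_ne x Λ N m hb).symm
        (N.f a b (Fin.cast (flip_ne Λ ha hb).symm i) (castL k (unrefl_d_ne x Λ N m ha) v)) := by
  simp only [unrefl, dif_neg ha, dif_neg hb]
  rfl

theorem unrefl_dim {k : Type} [Field k] {n : ℕ} (x : Fin n) (Λ : Fin n → Fin n → ℕ)
    (N : Rep k n (flipO x Λ)) (m : ℕ)
    (hinj : LinearMap.ker (outMap (flipO x Λ) N x) = ⊥) :
    (unrefl x Λ N m).d x + N.d x = ∑ y, Λ y x * N.d y + m := by
  rw [unrefl_d_self, Module.finrank_prod, Module.finrank_fin_fun]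
  have h1 := Submodule.finrank_quotient_add_finrank (LinearMap.range (outMap (flipO x Λ) N x))
  have h2 := LinearMap.finrank_range_add_finrank_ker (outMap (flipO x Λ) N x)
  rw [hinj, finrank_bot, Module.finrank_fin_fun] at h2
  rw [finrank_aout (flipO x Λ) N.d x] at h1
  simp only [flip_from] at h1
  omega

theorem emb_unrefl {k : Type} [Field k] {n : ℕ} (x : Fin n) (Λ : Fin n → Fin n → ℕ)
    (hl : ∀ a, Λ a a = 0) (hx : IsSink Λ x) (N : Rep k n (flipO x Λ)) (m : ℕ) :
    Emb (reflPlus x Λ (unrefl x Λ N m)) N := by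
  set M := unrefl x Λ N m with hM
  have hne : ∀ p : Aout (flipO x Λ) x, p.1 ≠ x := by
    rintro ⟨a, i⟩ h
    simp only at h
    subst h
    exact absurd i.2 (by have := loop_flip (x := a) hl a; omega)
  have hne' : ∀ p : Arin Λ x, p.1 ≠ x := by
    rintro ⟨a, i⟩ h
    simp only at h
    subst h
    exact absurd i.2 (by have := hl a; omega)
  let P : ((p : Arin Λ x) → (Fin (M.d p.1) → k)) →ₗ[k]
      ((p : Aout (flipO x Λ) x) → (Fin (N.d p.1) → k)) :=
    LinearMap.pi fun p => (castL k (unrefl_d_ne x Λ N m (hne p))).toLinearMap ∘ₗ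
      LinearMap.proj (⟨p.1, Fin.cast (flip_from Λ x p.1) p.2⟩ : Arin Λ x)
  have hP : ∀ v p, P v p = castL k (unrefl_d_ne x Λ N m (hne p))
      (v (⟨p.1, Fin.cast (flip_from Λ x p.1) p.2⟩ : Arin Λ x)) := fun v p => rfl
  have hin : ∀ v, inMap Λ M x v = castL k (unrefl_d_self x Λ N m).symm
        ((Module.finBasis k (QQ (flipO x Λ) N x m)).equivFun
          (LinearMap.inl k _ _ ((LinearMap.range (outMap (flipO x Λ) N x)).mkQ (P v)))) := by
    intro v
    have hsum : P v = ∑ p : Arin Λ x,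
        LinearMap.single k (fun p : Aout (flipO x Λ) x => Fin (N.d p.1) → k)
              (⟨p.1, Fin.cast (flip_from Λ x p.1).symm p.2⟩ : Aout (flipO x Λ) x)
              (castL k (unrefl_d_ne x Λ N m (hne' p)) (v p)) := by
      let ρ : Arin Λ x ≃ Aout (flipO x Λ) x :=
        Equiv.sigmaCongrRight fun y => finCongr (flip_from Λ x y).symm
      rw [← Equiv.sum_comp ρ.symm]
      have : ∀ q : Aout (flipO x Λ) x,
          LinearMap.single k (fun p : Aout (flipO x Λ) x => Fin (N.d p.1) → k)
              (⟨(ρ.symm q).1, Fin.cast (flip_from Λ x (ρ.symm q).1).symm (ρ.symm q).2⟩ :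
                Aout (flipO x Λ) x)
              (castL k (unrefl_d_ne x Λ N m (hne' (ρ.symm q))) (v (ρ.symm q)))
          = Pi.single q (P v q) := by
        rintro ⟨y, i⟩
        rfl
      simp only [this]
      exact (Finset.univ_sum_single (P v)).symm
    rw [inMap_apply, hsum]
    simp only [map_sum]
    refine Finset.sum_congr rfl fun p _ => ?_
    exact unrefl_f_to x Λ N m (hne' p) p.2 (v p)
  have hrange : ∀ v ∈ LinearMap.ker (inMap Λ M x), P v ∈ LinearMap.range (outMap (flipO x Λ) N x) := by
    intro v hv
    rw [LinearMap.mem_ker, hin, LinearEquiv.map_eq_zero_iff, LinearEquiv.map_eq_zero_iff] at hv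
    have h := congrArg Prod.fst hv
    simpa using h
  obtain ⟨s, hs⟩ := LinearMap.exists_rightInverse_of_surjective
    (outMap (flipO x Λ) N x).rangeRestrict (LinearMap.range_rangeRestrict _)
  have hs' : ∀ w : LinearMap.range (outMap (flipO x Λ) N x),
      outMap (flipO x Λ) N x (s w) = w.1 := by
    intro w
    exact congrArg Subtype.val (LinearMap.congr_fun hs w)
  apply emb_of_refl Λ x hx M N
    (s ∘ₗ P.restrict hrange)
    (fun z hz => (castL k (unrefl_d_ne x Λ N m hz)).toLinearMap)
  · intro u v huv
    have h1 : P u.1 = P v.1 := by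
      have := congrArg (outMap (flipO x Λ) N x) huv
      simp only [LinearMap.comp_apply, hs'] at this
      exact this
    apply Subtype.ext
    funext p
    have h2 := congrFun h1 (⟨p.1, Fin.cast (flip_from Λ x p.1).symm p.2⟩ : Aout (flipO x Λ) x)
    rw [hP, hP] at h2
    exact (castL k _).injective h2
  · intro z hz
    exact (castL k _).injective
  · intro b hb i v
    have := congrFun (hs' (P.restrict hrange v)) ⟨b, i⟩
    exact this
  · intro a b ha hb i v
    have h := unrefl_f_ne x Λ N m ha hb (Fin.cast (flip_ne Λ ha hb) i) v
    exact ((congrArg (castL k (unrefl_d_ne x Λ N m hb)) h).trans (castL_castL _ _ _)).symm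

theorem emb_simple {k : Type} [Field k] {n : ℕ} (Λ : Fin n → Fin n → ℕ) (x : Fin n)
    (N : Rep k n Λ) (κ : Fin (N.d x) → k) (h0 : κ ≠ 0) (hκ : outMap Λ N x κ = 0) :
    Emb (simpleRep Λ x) N := by
  let G : ∀ z, (Fin ((simpleRep (k := k) Λ x).d z) → k) →ₗ[k] (Fin (N.d z) → k) := fun z =>
    if h : z = x then
      (LinearMap.toSpanSingleton k _ (castL k (congrArg N.d h.symm) κ)) ∘ₗ
        (LinearMap.proj (⟨0, by simp [simpleRep, h]⟩ : Fin ((simpleRep (k := k) Λ x).d z)))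
    else 0
  refine ⟨⟨G, ?_⟩, ?_⟩
  · intro a b i v
    have h1 : (simpleRep (k := k) Λ x).f a b i v = 0 := rfl
    rw [h1, map_zero]
    by_cases ha : a = x
    · subst ha
      have h2 : N.f a b i κ = 0 := congrFun hκ ⟨b, i⟩
      simp only [G, dif_pos, LinearMap.comp_apply, LinearMap.toSpanSingleton_apply, map_smul]
      have h3 : castL k (congrArg N.d (rfl : a = a).symm) κ = κ := rfl
      rw [h3, h2, smul_zero]
    · simp [G, ha]
  · intro z u v huv
    by_cases hz : z = x
    · subst hz
      simp only [G, dif_pos, LinearMap.comp_apply, LinearMap.toSpanSingleton_apply] at huv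
      have h3 : castL k (congrArg N.d (rfl : z = z).symm) κ = κ := rfl
      rw [h3] at huv
      have h4 := smul_left_injective k h0 huv
      funext j
      have : j = ⟨0, by simp [simpleRep]⟩ := by
        apply Fin.ext
        have := j.2
        simp only [simpleRep, if_true] at this
        simp only
        omega
      rw [this]; exact h4
    · funext j
      have := j.2
      simp [simpleRep, hz] at this

/-- The main existence theorem. -/
theorem exists_module {k : Type} [Field k] {n : ℕ} (A : Fin n → Fin n → ℤ) (z : Fin n → ℤ)
    (hz0 : ∀ x, 0 < z x) (hz : ∀ x, ∑ l, A x l * z l ≤ 0) (L : ℕ) :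
    ∀ (l : List (Fin n × ℕ)) (_ : l.length ≤ L) (Λ : Fin n → Fin n → ℕ) (_ : cartanOf Λ = A)
      (_ : ∀ a, Λ a a = 0) (_ : Admissible Λ (l.map Prod.fst)),
      ∃ M : Rep k n Λ, Annihilates Λ (l.map Prod.fst) M ∧ dimv M = vec A l := by
  induction L with
  | zero =>
    intro l hL Λ _ _ _
    have : l = [] := List.length_eq_zero_iff.mp (by omega)
    subst this
    exact ⟨zeroRep k n Λ, fun _ => rfl, rfl⟩
  | succ L ih =>
    intro l hL Λ hA hl hS
    match l with
    | [] => exact ⟨zeroRep k n Λ, fun _ => rfl, rfl⟩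
    | (x, m) :: l' =>
      simp only [List.map_cons] at hS ⊢
      simp only [List.length_cons] at hL
      have hA' : cartanOf (flipO x Λ) = A := by rw [cartan_flip, hA]
      obtain ⟨N, hN0, hN⟩ := ih l' (by omega) (flipO x Λ) hA' (loop_flip hl) hS.2
      refine ⟨unrefl x Λ N m, ?_, ?_⟩
      · exact (emb_FList _ _ hS.2 _ _ (emb_unrefl x Λ hl hS.1 N m)).zero hN0
      -- the structure map is injective
      have hge : ∀ T, T <:+ l'.map Prod.fst → ∀ i, z i ≤ back A T z i := by
        rintro T ⟨V, hV⟩ i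
        have hT : Admissible (orientAfter (flipO x Λ) V) T := by
          have := hS.2
          rw [← hV, admissible_append] at this
          exact this.2
        have hAT : cartanOf (orientAfter (flipO x Λ) V) = A := by
          rw [← hA']
          funext a b
          simp only [cartanOf, edges_orient]
        have hlT : ∀ a, orientAfter (flipO x Λ) V a a = 0 := by
          intro a
          have h1 := edges_orient V (flipO x Λ) a a
          have h2 := loop_flip (x := x) hl a
          simp only [edges] at h1
          omega
        have hlen : T.length ≤ L := by
          have := congrArg List.length hV
          simp only [List.length_append, List.length_map] at this
          omega
        have hb := back_eq_vec Λ z (by rw [hA]; exact hz) T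
        rw [hA] at hb
        obtain ⟨M', -, hM'⟩ := ih (T.map fun x => (x, (- ∑ l, A x l * z l).toNat))
          (by simpa using hlen) _ hAT hlT (by simpa [List.map_map, Function.comp_def] using hT)
        rw [hb, ← hM']
        simp [dimv]
      have hker : LinearMap.ker (outMap (flipO x Λ) N x) = ⊥ := by
        by_contra hcon
        obtain ⟨κ, hκ, hκ0⟩ := Submodule.exists_mem_ne_zero_of_ne_bot hcon
        have hemb := emb_simple (flipO x Λ) x N κ hκ0 hκ
        have hzero := (emb_FList _ _ hS.2 _ _ hemb).zero hN0
        have hlow := eul_lower _ (flipO x Λ) (loop_flip hl) hS.2 (simpleRep (k := k) (flipO x Λ) x) z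
          (by rw [hA']; exact fun T hT i => (hz0 i).le.trans (hge T hT i))
        have h1 : dimv (FList (l'.map Prod.fst) (flipO x Λ) (simpleRep (k := k) (flipO x Λ) x))
            = 0 := by
          funext i; simp only [dimv, hzero i]; rfl
        have h2 : dimv (simpleRep (k := k) (flipO x Λ) x) = Pi.single x 1 := by
          funext i
          simp only [dimv, simpleRep, Pi.single_apply]
          split <;> simp
        have h3 : eul (orientAfter (flipO x Λ) (l'.map Prod.fst)) z 0 = 0 := by simp [eul]
        rw [h1, h2, h3, eul_source_right _ _ _ hS.1, hA'] at hlow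
        have h4 := hge _ List.suffix_rfl x
        have h5 := hz0 x
        omega
      have hd := unrefl_dim x Λ N m hker
      funext i
      simp only [vec, ← hN]
      rw [sigma_form, ← hA, cartan_sum_sink Λ hl x hS.1]
      by_cases hi : i = x
      · subst hi
        have hr' : (((unrefl i Λ N m).d i + N.d i : ℕ) : ℤ) =
          ((∑ y, Λ y i * N.d y + m : ℕ) : ℤ) := congrArg _ hd
        push_cast at hr'
        simp [dimv]
        linarith
      · simp [dimv, unrefl_d_ne x Λ N m hi, Pi.single_eq_of_ne hi]

/-! ## Length and positivity in the Weyl group -/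

/-- Membership in the Weyl group. -/
def InW {n : ℕ} (Λ : Fin n → Fin n → ℕ) (w : (Fin n → ℤ) ≃ₗ[ℤ] (Fin n → ℤ)) : Prop :=
  ∃ ys : List (Fin n), w = (ys.map (wSig Λ)).prod

/-- The length function. -/
noncomputable def ell {n : ℕ} (Λ : Fin n → Fin n → ℕ) (w : (Fin n → ℤ) ≃ₗ[ℤ] (Fin n → ℤ)) : ℕ :=
  wordLen (cartanOf Λ) (cartan_diag Λ) w

theorem wSig_apply {n : ℕ} (Λ : Fin n → Fin n → ℕ) (i : Fin n) (v : Fin n → ℤ) :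
    wSig Λ i v = sigmaL (cartanOf Λ) i v := rfl

theorem wSig_sq {n : ℕ} (Λ : Fin n → Fin n → ℕ) (i : Fin n) : wSig Λ i * wSig Λ i = 1 := by
  ext1 v
  exact sigma_sigma Λ i v

theorem mul_wSig_wSig {n : ℕ} (Λ : Fin n → Fin n → ℕ) (i : Fin n)
    (w : (Fin n → ℤ) ≃ₗ[ℤ] (Fin n → ℤ)) : w * wSig Λ i * wSig Λ i = w := by
  rw [mul_assoc, wSig_sq, mul_one]

theorem ell_le {n : ℕ} (Λ : Fin n → Fin n → ℕ) (ys : List (Fin n)) :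
    ell Λ (ys.map (wSig Λ)).prod ≤ ys.length :=
  Nat.sInf_le ⟨ys, rfl, rfl⟩

theorem ell_exists {n : ℕ} {Λ : Fin n → Fin n → ℕ} {w : (Fin n → ℤ) ≃ₗ[ℤ] (Fin n → ℤ)}
    (h : InW Λ w) : ∃ ys : List (Fin n), ys.length = ell Λ w ∧ w = (ys.map (wSig Λ)).prod := by
  obtain ⟨ys, hy⟩ := h
  exact Nat.sInf_mem (s := {l | ∃ ys : List (Fin n), ys.length = l ∧
    w = (ys.map (wSig Λ)).prod}) ⟨_, ys, rfl, hy⟩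

theorem InW_mul {n : ℕ} {Λ : Fin n → Fin n → ℕ} {w : (Fin n → ℤ) ≃ₗ[ℤ] (Fin n → ℤ)}
    (h : InW Λ w) (i : Fin n) : InW Λ (w * wSig Λ i) := by
  obtain ⟨ys, rfl⟩ := h
  exact ⟨ys ++ [i], by simp⟩

theorem ell_mul_le {n : ℕ} {Λ : Fin n → Fin n → ℕ} {w : (Fin n → ℤ) ≃ₗ[ℤ] (Fin n → ℤ)}
    (h : InW Λ w) (i : Fin n) : ell Λ (w * wSig Λ i) ≤ ell Λ w + 1 := by
  obtain ⟨ys, h1, h2⟩ := ell_exists h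
  have := ell_le Λ (ys ++ [i])
  simp only [List.map_append, List.map_cons, List.map_nil, List.prod_append, List.prod_singleton,
    ← h2, List.length_append, List.length_singleton, h1] at this
  exact this

theorem det_sigma {n : ℕ} (Λ : Fin n → Fin n → ℕ) (i : Fin n) :
    LinearMap.det (sigmaL (cartanOf Λ) i) = -1 := by
  rw [← LinearMap.det_toMatrix']
  have : LinearMap.toMatrix' (sigmaL (cartanOf Λ) i) =
      1 + Matrix.replicateCol Unit (fun a => - (Pi.single i 1 : Fin n → ℤ) a) *
        Matrix.replicateRow Unit (cartanOf Λ i) := by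
    ext a b
    rw [LinearMap.toMatrix'_apply, sigma_apply]
    simp [Matrix.one_apply, Matrix.mul_apply, Pi.single_apply, sub_eq_add_neg]
  rw [this, Matrix.det_one_add_replicateCol_mul_replicateRow]
  simp [dotProduct, Pi.single_apply, cartan_diag]

theorem det_word {n : ℕ} (Λ : Fin n → Fin n → ℕ) (ys : List (Fin n)) :
    LinearMap.det (((ys.map (wSig Λ)).prod : (Fin n → ℤ) ≃ₗ[ℤ] (Fin n → ℤ)) :
      (Fin n → ℤ) →ₗ[ℤ] (Fin n → ℤ)) = (-1) ^ ys.length := by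
  induction ys with
  | nil => simp
  | cons y ys ih =>
    have : ((((y :: ys).map (wSig Λ)).prod : (Fin n → ℤ) ≃ₗ[ℤ] (Fin n → ℤ)) :
      (Fin n → ℤ) →ₗ[ℤ] (Fin n → ℤ)) = sigmaL (cartanOf Λ) y *
        (((ys.map (wSig Λ)).prod : (Fin n → ℤ) ≃ₗ[ℤ] (Fin n → ℤ)) :
          (Fin n → ℤ) →ₗ[ℤ] (Fin n → ℤ)) := by
      simp only [List.map_cons, List.prod_cons]; rfl
    rw [this, map_mul, ih, det_sigma, List.length_cons, pow_succ]
    ring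

theorem ell_ne {n : ℕ} {Λ : Fin n → Fin n → ℕ} {w : (Fin n → ℤ) ≃ₗ[ℤ] (Fin n → ℤ)}
    (h : InW Λ w) (i : Fin n) : ell Λ (w * wSig Λ i) ≠ ell Λ w := by
  intro he
  obtain ⟨ys, h1, h2⟩ := ell_exists h
  obtain ⟨zs, h3, h4⟩ := ell_exists (InW_mul h i)
  have e1 := det_word Λ zs
  have e2 := det_word Λ (ys ++ [i])
  simp only [List.map_append, List.map_cons, List.map_nil, List.prod_append, List.prod_singleton,
    ← h2, List.length_append, List.length_singleton, h1] at e2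
  rw [← h4, h3, he] at e1
  rw [e1, pow_succ] at e2
  rcases neg_one_pow_eq_or ℤ (ell Λ w) with h | h <;> rw [h] at e2 <;> norm_num at e2

/-- The dichotomy for right multiplication by a simple reflection. -/
theorem ell_cases {n : ℕ} {Λ : Fin n → Fin n → ℕ} {w : (Fin n → ℤ) ≃ₗ[ℤ] (Fin n → ℤ)}
    (h : InW Λ w) (i : Fin n) : ell Λ w < ell Λ (w * wSig Λ i) ∨
      (ell Λ (w * wSig Λ i) < ell Λ w ∧ InW Λ (w * wSig Λ i) ∧
        ell Λ (w * wSig Λ i) < ell Λ (w * wSig Λ i * wSig Λ i)) := by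
  rcases lt_or_gt_of_ne (ell_ne h i) with h1 | h1
  · right; exact ⟨h1, InW_mul h i, by rwa [mul_wSig_wSig]⟩
  · left; exact h1

theorem rank_two_pos {n : ℕ} (Λ : Fin n → Fin n → ℕ) (L : ℕ)
    (IH : ∀ v, InW Λ v → ell Λ v < L → ∀ a, ell Λ v < ell Λ (v * wSig Λ a) →
      ∀ t, 0 ≤ v (Pi.single a 1) t) (m : ℕ) (hm : m < L) :
    ∀ v, InW Λ v → ell Λ v ≤ m → ∀ a b : Fin n, a ≠ b → 2 ≤ edges Λ a b →
      ell Λ v < ell Λ (v * wSig Λ a) → ∀ p q : ℤ, 0 ≤ q → q ≤ p →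
      ∀ t, 0 ≤ v (p • Pi.single a 1 + q • Pi.single b 1) t := by
  induction m with
  | zero =>
    intro v hv hvm a b hab hc hva p q hq hqp t
    have h1 := IH v hv (by omega) a hva t
    rcases ell_cases hv b with h | h
    · have h2 := IH v hv (by omega) b h t
      simp only [map_add, map_smul, Pi.add_apply, Pi.smul_apply, smul_eq_mul]
      exact add_nonneg (mul_nonneg (by omega) h1) (mul_nonneg hq h2)
    · omega
  | succ m ihm =>
    intro v hv hvm a b hab hc hva p q hq hqp t
    have h1 := IH v hv (by omega) a hva t
    rcases ell_cases hv b with h | ⟨h, h', h''⟩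
    · have h2 := IH v hv (by omega) b h t
      simp only [map_add, map_smul, Pi.add_apply, Pi.smul_apply, smul_eq_mul]
      exact add_nonneg (mul_nonneg (by omega) h1) (mul_nonneg hq h2)
    · have h3 := ihm (by omega) (v * wSig Λ b) h' (by omega) b a hab.symm
        (by rw [edges_symm]; exact hc) h'' (p * edges Λ b a - q) p (by omega) (by
          have : (2 : ℤ) ≤ edges Λ b a := by rw [edges_symm]; exact_mod_cast hc
          nlinarith) t
      have h4 : wSig Λ b ((p * (edges Λ b a : ℤ) - q) • Pi.single b 1 + p • Pi.single a 1) =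
          p • Pi.single a 1 + q • Pi.single b 1 := by
        rw [wSig_apply, map_add, map_smul, map_smul, sigma_single_self,
          sigma_single_ne Λ b a hab.symm]
        ext s
        simp only [Pi.add_apply, Pi.smul_apply, smul_eq_mul, Pi.neg_apply]
        ring
      rw [LinearEquiv.mul_apply, h4] at h3
      exact h3

theorem pos_of_len {n : ℕ} (Λ : Fin n → Fin n → ℕ) (hl : ∀ a, Λ a a = 0) (L : ℕ) :
    ∀ w, InW Λ w → ell Λ w < L → ∀ i, ell Λ w < ell Λ (w * wSig Λ i) →
      ∀ t, 0 ≤ w (Pi.single i 1) t := by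
  induction L with
  | zero => intro w _ h; omega
  | succ L ih =>
    intro w hw hwL i hi t
    obtain ⟨ys, h1, h2⟩ := ell_exists hw
    rcases List.eq_nil_or_concat ys with rfl | ⟨zs, j, rfl⟩
    · simp only [List.map_nil, List.prod_nil] at h2
      rw [h2, LinearEquiv.coe_one, id, Pi.single_apply]
      split <;> norm_num
    set v := w * wSig Λ j with hvdef
    have hv : InW Λ v := InW_mul hw j
    have hwv : w = v * wSig Λ j := (mul_wSig_wSig Λ j w).symm
    have hvl : ell Λ v < ell Λ w := by
      have e : v = (zs.map (wSig Λ)).prod := by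
        rw [hvdef, h2]
        simp [mul_assoc, wSig_sq]
      have := ell_le Λ zs
      rw [← e] at this
      simp at h1
      omega
    have hij : i ≠ j := by
      rintro rfl
      rw [← hvdef] at hi; omega
    have hji : j ≠ i := hij.symm
    have hvj : ell Λ v < ell Λ (v * wSig Λ j) := by rw [← hwv]; exact hvl
    have hwe : w (Pi.single i 1) = v (Pi.single i 1 + (edges Λ j i : ℤ) • Pi.single j 1) := by
      rw [hwv, LinearEquiv.mul_apply, wSig_apply, sigma_single_ne Λ j i hji]
    rcases Nat.lt_or_ge (edges Λ j i) 2 with hc | hc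
    · have pj := ih v hv (by omega) j hvj t
      rcases ell_cases hv i with h | ⟨h, h', h''⟩
      · have pi := ih v hv (by omega) i h t
        rw [hwe, map_add, map_smul, Pi.add_apply, Pi.smul_apply, smul_eq_mul]
        positivity
      · set v' := v * wSig Λ i with hv'
        have hvv' : v = v' * wSig Λ i := (mul_wSig_wSig Λ i v).symm
        have hc' : edges Λ j i = 0 ∨ edges Λ j i = 1 := by omega
        rcases hc' with hc0 | hc1
        · exfalso
          have e : w * wSig Λ i = v' * wSig Λ j := by
            have e0 : wSig Λ i * (wSig Λ j * wSig Λ i) = wSig Λ j := by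
              ext1 x
              simp only [LinearEquiv.mul_apply, wSig_apply]
              rw [sigma_comm Λ j i hc0, sigma_sigma]
            calc w * wSig Λ i = v' * wSig Λ i * wSig Λ j * wSig Λ i := by rw [← hvv', ← hwv]
              _ = v' * (wSig Λ i * (wSig Λ j * wSig Λ i)) := by simp only [mul_assoc]
              _ = v' * wSig Λ j := by rw [e0]
          have := ell_mul_le h' j
          rw [← e] at this
          omega
        · have hc1' : edges Λ i j = 1 := by rw [edges_symm]; exact hc1
          rcases ell_cases h' j with k1 | ⟨k1, k2, k3⟩
          · have := ih v' h' (by omega) j k1 t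
            have e : w (Pi.single i 1) = v' (Pi.single j 1) := by
              rw [hwe, hvv', LinearEquiv.mul_apply, hc1, wSig_apply, map_add, map_smul,
                sigma_single_self, sigma_single_ne Λ i j hij, hc1']
              congr 1
              ext s
              simp only [Pi.add_apply, Pi.smul_apply, smul_eq_mul, Pi.neg_apply]
              ring
            rw [e]; exact this
          · exfalso
            set u := v' * wSig Λ j with hu
            have hv'u : v' = u * wSig Λ j := (mul_wSig_wSig Λ j v').symm
            have e : w * wSig Λ i = u * wSig Λ i * wSig Λ j := by
              rw [hwv, hvv', hv'u]
              simp only [mul_assoc]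
              congr 1
              have br : wSig Λ j * (wSig Λ i * wSig Λ j) = wSig Λ i * (wSig Λ j * wSig Λ i) := by
                ext1 x
                simp only [LinearEquiv.mul_apply, wSig_apply]
                simp only [sigma_form (cartanOf Λ) _ x]
                simp only [map_sub, map_smul, sigma_single_self, sigma_single_ne Λ i j hij,
                  sigma_single_ne Λ j i hji, hc1, hc1', map_add, map_neg]
                simp only [sigma_form (cartanOf Λ) _ x]
                simp only [map_sub, map_smul, sigma_single_self, sigma_single_ne Λ i j hij,
                  sigma_single_ne Λ j i hji, hc1, hc1', map_add, map_neg]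
                simp only [sigma_form (cartanOf Λ) _ x]
                ext s
                simp only [Pi.add_apply, Pi.smul_apply, smul_eq_mul, Pi.neg_apply, Pi.sub_apply]
                push_cast
                ring
              calc wSig Λ j * (wSig Λ i * (wSig Λ j * wSig Λ i))
                  = (wSig Λ j * (wSig Λ i * wSig Λ j)) * wSig Λ i := by simp only [mul_assoc]
                _ = wSig Λ i * (wSig Λ j * wSig Λ i) * wSig Λ i := by rw [br]
                _ = wSig Λ i * wSig Λ j := by
                  simp only [mul_assoc, wSig_sq, mul_one]
            have a1 := ell_mul_le k2 i
            have a2 := ell_mul_le (InW_mul k2 i) j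
            rw [← e] at a2
            omega
    · have := rank_two_pos Λ L ih (ell Λ v) (by omega) v hv le_rfl j i hji hc hvj
        (edges Λ j i) 1 (by norm_num) (by exact_mod_cast (by omega)) t
      rw [hwe, add_comm]
      simpa using this

theorem back_eq_word {n : ℕ} (Λ : Fin n → Fin n → ℕ) (S : List (Fin n)) (p : Fin n → ℤ) :
    back (cartanOf Λ) S p = ((S.map (wSig Λ)).prod : (Fin n → ℤ) ≃ₗ[ℤ] (Fin n → ℤ)) p := by
  induction S with
  | nil => simp [back]
  | cons x S ih => simp only [back, ih, List.map_cons, List.prod_cons, LinearEquiv.mul_apply]; rfl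

/-- Positivity of the roots attached to a sequence makes the word reduced. -/
theorem ell_of_pos {n : ℕ} (Λ : Fin n → Fin n → ℕ) (hl : ∀ a, Λ a a = 0) (S : List (Fin n)) :
    (∀ T y U, S = T ++ y :: U → ∀ t, 0 ≤ back (cartanOf Λ) T (Pi.single y 1) t) →
    ell Λ (S.map (wSig Λ)).prod = S.length := by
  induction S using List.reverseRecOn with
  | nil => intro _; have := ell_le Λ []; simp at this ⊢; exact this
  | append_singleton S x ih =>
    intro h
    have h0 := ih (fun T y U e => h T y (U ++ [x]) (by simp [e]))
    have hp := h S x [] rfl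
    set w := (S.map (wSig Λ)).prod with hw
    have hW : InW Λ w := ⟨S, rfl⟩
    have e : ((S ++ [x]).map (wSig Λ)).prod = w * wSig Λ x := by simp [hw]
    rw [e, List.length_append, List.length_singleton, ← h0]
    rcases ell_cases hW x with h1 | ⟨h1, h2, h3⟩
    · have := ell_mul_le hW x; omega
    · exfalso
      have q := pos_of_len Λ hl _ _ h2 (Nat.lt_succ_self _) x h3
      rw [back_eq_word, ← hw] at hp
      have e2 : (w * wSig Λ x) (Pi.single x 1) = - w (Pi.single x 1) := by
        rw [LinearEquiv.mul_apply, wSig_apply, sigma_single_self, map_neg]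
      have z : w (Pi.single x 1) = 0 := by
        funext t
        have a1 := q t
        rw [e2, Pi.neg_apply] at a1
        have a2 := hp t
        simp only [Pi.zero_apply]
        omega
      rw [LinearEquiv.map_eq_zero_iff] at z
      have := congrFun z x
      simp at this

theorem word_rev {n : ℕ} (Λ : Fin n → Fin n → ℕ) (S : List (Fin n)) :
    ((S.reverse).map (wSig Λ)).prod = ((S.map (wSig Λ)).prod)⁻¹ := by
  induction S with
  | nil => simp
  | cons x S ih =>
    simp only [List.reverse_cons, List.map_append, List.prod_append, ih, List.map_cons,
      List.map_nil, List.prod_singleton, List.prod_cons, mul_inv_rev]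
    congr 1

theorem ell_rev {n : ℕ} (Λ : Fin n → Fin n → ℕ) (S : List (Fin n))
    (h : ell Λ (S.map (wSig Λ)).prod = S.length) : IsReducedSeq Λ S := by
  have h1 : ell Λ (wordOfSeq Λ S) ≤ S.length := by
    have := ell_le Λ S.reverse
    simpa [wordOfSeq] using this
  obtain ⟨zs, h3, h4⟩ := ell_exists (Λ := Λ) (w := wordOfSeq Λ S) ⟨S.reverse, rfl⟩
  have h5 : ell Λ (S.map (wSig Λ)).prod ≤ zs.length := by
    have e : (S.map (wSig Λ)).prod = ((zs.reverse).map (wSig Λ)).prod := by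
      rw [word_rev, ← h4, wordOfSeq, word_rev, inv_inv]
    rw [e]
    have := ell_le Λ zs.reverse
    simpa using this
  show ell Λ (wordOfSeq Λ S) = S.length
  omega

/-- Part (a). -/
theorem reduced_of_sincere {n : ℕ} (Λ : Fin n → Fin n → ℕ) (hl : ∀ a, Λ a a = 0)
    (hpos : ∀ T y, Admissible Λ (T ++ [y]) → ∀ t, 0 ≤ back (cartanOf Λ) T (Pi.single y 1) t)
    (S : List (Fin n)) (hS : Admissible Λ S) : IsReducedSeq Λ S := by
  apply ell_rev
  apply ell_of_pos Λ hl
  intro T y U e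
  apply hpos
  have : S = (T ++ [y]) ++ U := by simp [e]
  rw [this, admissible_append] at hS
  exact hS.1

theorem root_pos (k : Type) [Field k] {n : ℕ} (Λ : Fin n → Fin n → ℕ) (hl : ∀ a, Λ a a = 0)
    (z : Fin n → ℤ) (hz0 : ∀ x, 0 < z x) (hz : ∀ x, ∑ l, cartanOf Λ x l * z l ≤ 0)
    (T : List (Fin n)) (y : Fin n) (hT : Admissible Λ (T ++ [y])) (t : Fin n) :
    0 ≤ back (cartanOf Λ) T (Pi.single y 1) t := by
  have hm : (((T.map fun x => (x, 0)) ++ [(y, 1)]).map Prod.fst : List (Fin n)) = T ++ [y] := by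
    simp [Function.comp_def]
  obtain ⟨M, _, hM⟩ := exists_module (k := k) (cartanOf Λ) z hz0 hz _
    ((T.map fun x => (x, 0)) ++ [(y, 1)]) le_rfl Λ rfl hl (by rw [hm]; exact hT)
  rw [back_single_eq_vec, ← hM]
  simp [dimv]

/-! ## Shortest annihilating sequences -/

/-- `y` is a letter of the sequence that can be moved to the end. -/
def IsMx {n : ℕ} (Λ : Fin n → Fin n → ℕ) (y : Fin n) : List (Fin n) → Prop
  | [] => False
  | x :: S => IsMx Λ y S ∨ (y = x ∧ ∀ u ∈ S, u ≠ x ∧ edges Λ u x = 0)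

open Classical in
/-- Attach multiplicity one to the letters that can be moved to the end. -/
noncomputable def deco {n : ℕ} (Λ : Fin n → Fin n → ℕ) : List (Fin n) → List (Fin n × ℕ)
  | [] => []
  | x :: S => (x, if ∀ u ∈ S, u ≠ x ∧ edges Λ u x = 0 then 1 else 0) :: deco Λ S

theorem deco_fst {n : ℕ} (Λ : Fin n → Fin n → ℕ) (S : List (Fin n)) :
    (deco Λ S).map Prod.fst = S := by
  induction S with
  | nil => rfl
  | cons x S ih => simp [deco, ih]

theorem IsMx_mem {n : ℕ} (Λ : Fin n → Fin n → ℕ) (y : Fin n) (S : List (Fin n))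
    (h : IsMx Λ y S) : y ∈ S := by
  induction S with
  | nil => exact h.elim
  | cons x S ih =>
    rcases h with h | ⟨h, _⟩
    · exact List.mem_cons_of_mem _ (ih h)
    · rw [h]; exact List.mem_cons_self

theorem IsMx_last {n : ℕ} (Λ : Fin n → Fin n → ℕ) (y : Fin n) (S : List (Fin n)) :
    IsMx Λ y (S ++ [y]) := by
  induction S with
  | nil => right; simp
  | cons x S ih => left; exact ih

theorem IsMx_swap {n : ℕ} (Λ : Fin n → Fin n → ℕ) (y a b : Fin n) (h : edges Λ a b = 0)
    (l : List (Fin n)) (hm : IsMx Λ y (a :: b :: l)) : IsMx Λ y (b :: a :: l) := by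
  have h' : edges Λ b a = 0 := by rw [edges_symm]; exact h
  by_cases hab : a = b
  · subst hab; exact hm
  · simp only [IsMx, List.mem_cons, forall_eq_or_imp] at hm ⊢
    rcases hm with (hm | ⟨h1, h2⟩) | ⟨h1, h2, h3⟩
    · left; left; exact hm
    · right; exact ⟨h1, ⟨hab, h⟩, h2⟩
    · left; right; exact ⟨h1, h3⟩

theorem IsMx_app {n : ℕ} (Λ : Fin n → Fin n → ℕ) (y : Fin n) (L L' l : List (Fin n))
    (h1 : ∀ u, u ∈ L' → u ∈ L) (h2 : IsMx Λ y L → IsMx Λ y L') (h : IsMx Λ y (l ++ L)) :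
    IsMx Λ y (l ++ L') := by
  induction l with
  | nil => exact h2 h
  | cons x l ih =>
    rcases h with h | ⟨h3, h4⟩
    · left; exact ih h
    · right
      refine ⟨h3, fun u hu => h4 u ?_⟩
      rcases List.mem_append.mp hu with hu | hu
      · exact List.mem_append_left _ hu
      · exact List.mem_append_right _ (h1 u hu)

theorem IsMx_sim {n : ℕ} (Λ : Fin n → Fin n → ℕ) (y : Fin n) {S T : List (Fin n)}
    (h : Sim (edges Λ) S T) (hS : IsMx Λ y S) : IsMx Λ y T := by
  induction h with
  | refl => exact hS
  | tail _ hs ih =>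
    cases hs with
    | swap l₁ l₂ a b hab =>
      refine IsMx_app Λ y _ _ l₁ ?_ (IsMx_swap Λ y a b hab l₂) ih
      intro u hu
      simp only [List.mem_cons] at hu ⊢
      tauto

theorem IsMx_edges {n : ℕ} (Λ : Fin n → Fin n → ℕ) (hl : ∀ a, Λ a a = 0) (y z : Fin n)
    (S : List (Fin n)) (hy : IsMx Λ y S) (hz : IsMx Λ z S) : edges Λ y z = 0 := by
  induction S with
  | nil => exact hy.elim
  | cons x S ih =>
    rcases hy with hy | ⟨hy, hy'⟩
    · rcases hz with hz | ⟨hz, hz'⟩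
      · exact ih hy hz
      · rw [hz]; exact (hz' y (IsMx_mem Λ y S hy)).2
    · rcases hz with hz | ⟨hz, hz'⟩
      · rw [hy, edges_symm]; exact (hy' z (IsMx_mem Λ z S hz)).2
      · rw [hy, hz]; simp [edges, hl]

theorem fwd_single_fix {n : ℕ} (Λ : Fin n → Fin n → ℕ) (x : Fin n) (S : List (Fin n))
    (h : ∀ u ∈ S, u ≠ x ∧ edges Λ u x = 0) :
    fwd (cartanOf Λ) S (Pi.single x 1) = Pi.single x 1 := by
  induction S with
  | nil => rfl
  | cons u S ih =>
    have hu := h u List.mem_cons_self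
    rw [fwd, sigma_single_ne Λ u x hu.1, hu.2]
    simp only [Nat.cast_zero, zero_smul, add_zero]
    exact ih fun v hv => h v (List.mem_cons_of_mem _ hv)

open Classical in
theorem fwd_deco {n : ℕ} (Λ : Fin n → Fin n → ℕ) (S : List (Fin n)) :
    fwd (cartanOf Λ) S (vec (cartanOf Λ) (deco Λ S)) = fun z => if IsMx Λ z S then -1 else 0 := by
  induction S with
  | nil => funext z; simp [fwd, deco, vec, IsMx]
  | cons x S ih =>
    rw [deco, vec, fwd, map_add, sigma_sigma, map_smul, sigma_single_self, fwd_add, ih]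
    by_cases h : ∀ u ∈ S, u ≠ x ∧ edges Λ u x = 0
    · rw [if_pos h, Nat.cast_one, one_smul, fwd_neg, fwd_single_fix Λ x S h]
      funext z
      by_cases hz : z = x
      · subst hz
        have h1 : ¬ IsMx Λ z S := fun hh => (h z (IsMx_mem Λ z S hh)).1 rfl
        have h2 : IsMx Λ z (z :: S) := Or.inr ⟨rfl, h⟩
        simp [h1, h2]
      · have : IsMx Λ z (x :: S) ↔ IsMx Λ z S := by simp [IsMx, hz]
        simp [this, Pi.single_apply, hz]
    · rw [if_neg h, Nat.cast_zero, zero_smul]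
      have e : fwd (cartanOf Λ) S (0 : Fin n → ℤ) = 0 := by
        have := fwd_add (cartanOf Λ) S 0 0
        simpa using this
      rw [e, add_zero]
      funext z
      have : IsMx Λ z (x :: S) ↔ IsMx Λ z S := by
        simp only [IsMx]
        exact ⟨fun hh => hh.elim id fun h2 => absurd h2.2 h, Or.inl⟩
      simp [this]

/-- Part (b). -/
theorem shortest_exists (k : Type) [Field k] {n : ℕ} (Λ : Fin n → Fin n → ℕ)
    (hl : ∀ a, Λ a a = 0)
    (z : Fin n → ℤ) (hz0 : ∀ x, 0 < z x) (hz : ∀ x, ∑ l, cartanOf Λ x l * z l ≤ 0)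
    (S : List (Fin n)) (hS : Admissible Λ S) :
    ∃ M : Rep k n Λ, Preprojective Λ M ∧ IsShortestAnn Λ M S := by
  classical
  obtain ⟨M, hM, hd⟩ := exists_module (k := k) (cartanOf Λ) z hz0 hz _
    (deco Λ S) le_rfl Λ rfl hl (by rw [deco_fst]; exact hS)
  rw [deco_fst] at hM
  refine ⟨M, ⟨S, hS, hM⟩, hS, hM, ?_⟩
  rintro T hT hTM ⟨U, hU, hsim⟩
  rcases List.eq_nil_or_concat U with rfl | ⟨U', y, rfl⟩
  · rw [List.append_nil] at hsim
    exact sim_symm Λ hsim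
  · exfalso
    rw [List.concat_eq_append, ← List.append_assoc] at hsim
    have hadm : Admissible Λ (T ++ U' ++ [y]) := by
      rw [List.append_assoc, admissible_append]
      rw [List.concat_eq_append] at hU
      exact ⟨hT, hU⟩
    set T2 := T ++ U' with hT2
    have hadm2 := (admissible_append T2 Λ [y]).mp hadm
    have hann : Annihilates Λ T2 M := annihilates_append T U' Λ M hTM
    have hsink : IsSink (orientAfter Λ T2) y := hadm2.2.1
    have hlow := eul_lower T2 Λ hl hadm2.1 M (Pi.single y 1) (by
      rintro V ⟨R, hR⟩ i
      have h3 : Admissible (orientAfter Λ R) (V ++ [y]) := by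
        rw [← hR, List.append_assoc, admissible_append] at hadm
        exact hadm.2
      have hc : cartanOf (orientAfter Λ R) = cartanOf Λ := by
        funext a b; simp only [cartanOf, edges_orient]
      have hl' : ∀ a, orientAfter Λ R a a = 0 := by
        intro a
        have := edges_orient R Λ a a
        simp only [edges, hl] at this
        omega
      have := root_pos k (orientAfter Λ R) hl' z hz0 (by rw [hc]; exact hz) V y h3 i
      rwa [hc] at this)
    rw [eul_sink_left _ _ _ hsink] at hlow
    have h0 : dimv (FList T2 Λ M) y = 0 := by
      have := hann y
      simp [dimv, this]
    rw [h0] at hlow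
    have hb : back (cartanOf Λ) T2 (Pi.single y 1) = (-1 : ℤ) • back (cartanOf Λ) S (Pi.single y 1) := by
      rw [back_sim Λ hsim, back_append _ T2 [y]]
      simp only [back, sigma_single_self, back_neg, neg_smul, one_smul, neg_neg]
    have hyS : IsMx Λ y S := IsMx_sim Λ y (sim_symm Λ hsim) (IsMx_last Λ y T2)
    rw [hb, eul_smul_left, ← eul_fwd S Λ hl hS, hd, fwd_deco, eul_single_left, if_pos hyS] at hlow
    have hsum : ∑ b, (orientAfter Λ S y b : ℤ) * (if IsMx Λ b S then (-1 : ℤ) else 0) = 0 := by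
      apply Finset.sum_eq_zero
      intro b _
      by_cases hbS : IsMx Λ b S
      · have h4 := IsMx_edges Λ hl y b S hyS hbS
        rw [← edges_orient S] at h4
        have : orientAfter Λ S y b = 0 := by unfold edges at h4; omega
        simp [this]
      · simp [hbS]
    rw [hsum] at hlow
    norm_num at hlow

/-! ## Graphs without a nonnegative subadditive obstruction are Dynkin -/

/-- There is a nonzero nonnegative vector on which the Cartan form is nonpositive. -/
def HasZ {ι : Type} [Fintype ι] (G : ι → ι → ℕ) : Prop :=
  ∃ z : ι → ℕ, (∃ i, z i ≠ 0) ∧ ∀ i, 2 * z i ≤ ∑ j, G i j * z j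

theorem hasZ_emb {ι κ : Type} [Fintype ι] [Fintype κ] (G : ι → ι → ℕ) (E : κ → κ → ℕ) (ψ : ι → κ)
    (hψ : Function.Injective ψ) (hG : ∀ s t, G s t ≤ E (ψ s) (ψ t)) (h : HasZ G) : HasZ E := by
  classical
  obtain ⟨z, ⟨i, hi⟩, hz⟩ := h
  have hval : ∀ s, (∑ t, if ψ t = ψ s then z t else 0) = z s := by
    intro s
    rw [Finset.sum_eq_single s]
    · simp
    · intro t _ ht
      rw [if_neg fun h => ht (hψ h)]
    · simp
  refine ⟨fun u => ∑ t, if ψ t = u then z t else 0, ⟨ψ i, by simp only [hval]; exact hi⟩, ?_⟩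
  intro u
  by_cases hu : ∃ s, ψ s = u
  · obtain ⟨s, rfl⟩ := hu
    simp only [hval]
    have e : ∑ j, E (ψ s) j * (∑ t, if ψ t = j then z t else 0) = ∑ t, E (ψ s) (ψ t) * z t := by
      simp only [Finset.mul_sum]
      rw [Finset.sum_comm]
      apply Finset.sum_congr rfl
      intro t _
      simp
    rw [e]
    exact (hz s).trans (Finset.sum_le_sum fun t _ => Nat.mul_le_mul_right _ (hG s t))
  · have : (∑ t, if ψ t = u then z t else 0) = 0 := by
      apply Finset.sum_eq_zero
      intro t _
      rw [if_neg fun h => hu ⟨t, h⟩]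
    simp only [this]
    simp

theorem sum_insert_sq {ι : Type} [DecidableEq ι] (G : ι → ι → ℕ) (hs : ∀ a b, G a b = G b a)
    (h0 : ∀ a, G a a = 0) (X : Finset ι) (v : ι) (hv : v ∉ X) :
    ∑ a ∈ insert v X, ∑ b ∈ insert v X, G a b =
      ∑ a ∈ X, ∑ b ∈ X, G a b + 2 * ∑ b ∈ X, G v b := by
  rw [Finset.sum_insert hv]
  simp only [Finset.sum_insert hv, Finset.sum_add_distrib, h0]
  have : ∑ a ∈ X, G a v = ∑ a ∈ X, G v a := Finset.sum_congr rfl fun a _ => hs a v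
  rw [this]
  ring

/-- A graph with too many edges has an obstruction. -/
theorem hasZ_of_many {ι : Type} [Fintype ι] [DecidableEq ι] (G : ι → ι → ℕ)
    (hs : ∀ a b, G a b = G b a) (h0 : ∀ a, G a a = 0) (m : ℕ) :
    ∀ X : Finset ι, X.card = m → X.Nonempty → 2 * m ≤ ∑ a ∈ X, ∑ b ∈ X, G a b → HasZ G := by
  induction m with
  | zero => intro X hX hne _; simp at hX; simp [hX] at hne
  | succ m ih =>
    intro X hX hne hsum
    by_cases hd : ∀ a ∈ X, 2 ≤ ∑ b ∈ X, G a b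
    · obtain ⟨x, hx⟩ := hne
      refine ⟨fun u => if u ∈ X then 1 else 0, ⟨x, by simp [hx]⟩, ?_⟩
      intro u
      have e : ∑ j, G u j * (if j ∈ X then 1 else 0) = ∑ b ∈ X, G u b := by
        simp
      rw [e]
      by_cases hu : u ∈ X
      · simpa [hu] using hd u hu
      · simp [hu]
    · push Not at hd
      obtain ⟨v, hv, hlt⟩ := hd
      have hvn : v ∉ X.erase v := Finset.notMem_erase v X
      have h1 := sum_insert_sq G hs h0 (X.erase v) v hvn
      rw [Finset.insert_erase hv] at h1
      have h2 : ∑ b ∈ X.erase v, G v b ≤ ∑ b ∈ X, G v b :=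
        Finset.sum_le_sum_of_subset (Finset.erase_subset _ _)
      have hc : (X.erase v).card = m := by rw [Finset.card_erase_of_mem hv]; omega
      apply ih (X.erase v) hc
      · by_contra hem
        rw [Finset.not_nonempty_iff_eq_empty] at hem
        rw [hem] at h1
        simp only [Finset.sum_empty] at h1
        omega
      · omega

theorem exists_boundary {ι : Type} (R : ι → ι → Prop) (X : Set ι) (r s : ι) (hr : s ∈ X)
    (hs : r ∉ X) (h : Relation.ReflTransGen R r s) : ∃ v u, v ∉ X ∧ u ∈ X ∧ R v u := by
  induction h with
  | refl => exact absurd hr hs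
  | @tail b c hb hbc ih =>
    by_cases hbX : b ∈ X
    · exact ih hbX
    · exact ⟨b, c, hbX, hr, hbc⟩

theorem sum_of_conn {ι : Type} [Fintype ι] [DecidableEq ι] (G : ι → ι → ℕ)
    (hs : ∀ a b, G a b = G b a) (h0 : ∀ a, G a a = 0) (r : ι)
    (hc : ∀ s, Relation.ReflTransGen (fun a b => G a b ≠ 0) s r) (m : ℕ) :
    m + 1 ≤ Fintype.card ι → ∃ X : Finset ι, r ∈ X ∧ X.card = m + 1 ∧
      2 * m ≤ ∑ a ∈ X, ∑ b ∈ X, G a b := by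
  induction m with
  | zero => intro _; exact ⟨{r}, by simp, by simp, by simp⟩
  | succ m ih =>
    intro hm
    obtain ⟨X, hr, hX, hsum⟩ := ih (by omega)
    have : ∃ s, s ∉ X := by
      by_contra hall
      push Not at hall
      have : X = Finset.univ := Finset.eq_univ_of_forall hall
      rw [this, Finset.card_univ] at hX
      omega
    obtain ⟨s, hsX⟩ := this
    obtain ⟨v, u, hv, hu, hvu⟩ := exists_boundary (fun a b => G a b ≠ 0) (X : Set ι) s r
      (by simpa using hr) (by simpa using hsX) (hc s)
    have hv' : v ∉ X := by simpa using hv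
    have hu' : u ∈ X := by simpa using hu
    refine ⟨insert v X, Finset.mem_insert_of_mem hr, ?_, ?_⟩
    · rw [Finset.card_insert_of_notMem hv', hX]
    · rw [sum_insert_sq G hs h0 X v hv']
      have : G v u ≤ ∑ b ∈ X, G v b :=
        Finset.single_le_sum (f := fun b => G v b) (fun _ _ => Nat.zero_le _) hu'
      omega

/-- A spanning connected subgraph is everything unless there is an obstruction. -/
theorem exact_of_ge {ι : Type} [Fintype ι] (T G : ι → ι → ℕ)
    (hs : ∀ a b, G a b = G b a) (h0 : ∀ a, G a a = 0) (hTs : ∀ a b, T a b = T b a)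
    (r : ι) (hc : ∀ s, Relation.ReflTransGen (fun a b => T a b ≠ 0) s r)
    (hle : ∀ a b, T a b ≤ G a b) (hno : ¬ HasZ G) : ∀ a b, G a b = T a b := by
  classical
  by_contra hne
  push Not at hne
  obtain ⟨a, b, hab⟩ := hne
  have hT0 : ∀ a, T a a = 0 := fun a => by have := hle a a; rw [h0] at this; omega
  have hab' : a ≠ b := by rintro rfl; rw [h0, hT0] at hab; exact hab rfl
  have hcard : 0 < Fintype.card ι := Fintype.card_pos_iff.mpr ⟨r⟩
  obtain ⟨X, _, hX, hsum⟩ := sum_of_conn T hTs hT0 r hc (Fintype.card ι - 1) (by omega)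
  have hXu : X = Finset.univ := by
    rw [← Finset.card_eq_iff_eq_univ]; omega
  rw [hXu] at hsum
  apply hno
  apply hasZ_of_many G hs h0 (Fintype.card ι) Finset.univ Finset.card_univ ⟨r, Finset.mem_univ _⟩
  have key : ∀ s t, T s t + (if s = a ∧ t = b then 1 else 0) + (if s = b ∧ t = a then 1 else 0)
      ≤ G s t := by
    intro s t
    have h1 := hle s t
    have h2 : T a b < G a b := lt_of_le_of_ne (hle a b) (Ne.symm hab)
    have h3 : T b a < G b a := by rw [hTs, hs]; exact h2
    by_cases c1 : s = a ∧ t = b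
    · have c2 : ¬ (s = b ∧ t = a) := fun c => hab' (c1.1.symm.trans c.1)
      rw [if_pos c1, if_neg c2, c1.1, c1.2]; omega
    · by_cases c2 : s = b ∧ t = a
      · rw [if_neg c1, if_pos c2, c2.1, c2.2]; omega
      · rw [if_neg c1, if_neg c2]; omega
  have e1 : ∀ a b : ι, ∑ s, ∑ t, (if s = a ∧ t = b then 1 else 0) = 1 := by
    intro a b
    simp [ite_and]
  have h4 : ∑ s, ∑ t, (T s t + (if s = a ∧ t = b then 1 else 0) +
      (if s = b ∧ t = a then 1 else 0)) ≤ ∑ s, ∑ t, G s t :=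
    Finset.sum_le_sum fun s _ => Finset.sum_le_sum fun t _ => key s t
  simp only [Finset.sum_add_distrib] at h4
  rw [e1, e1] at h4
  omega

/-- Enlarge the support of an obstruction until it is sincere. -/
theorem sincere_of_hasZ {ι : Type} [Fintype ι] (G : ι → ι → ℕ)
    (hc : ∀ a b, Relation.ReflTransGen (fun a b => G a b ≠ 0) a b) (h : HasZ G) :
    ∃ z : ι → ℕ, (∀ i, 0 < z i) ∧ ∀ i, 2 * z i ≤ ∑ j, G i j * z j := by
  classical
  have main : ∀ m : ℕ, ∀ z : ι → ℕ, (∃ i, z i ≠ 0) → (∀ i, 2 * z i ≤ ∑ j, G i j * z j) →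
      (Finset.univ.filter fun i => z i = 0).card ≤ m →
      ∃ z : ι → ℕ, (∀ i, 0 < z i) ∧ ∀ i, 2 * z i ≤ ∑ j, G i j * z j := by
    intro m
    induction m with
    | zero =>
      intro z _ h2 h3
      refine ⟨z, fun i => ?_, h2⟩
      by_contra hi
      have : i ∈ Finset.univ.filter fun i => z i = 0 := by simp; omega
      rw [Nat.le_zero, Finset.card_eq_zero] at h3
      rw [h3] at this
      simp at this
    | succ m ih =>
      intro z h1 h2 h3
      by_cases hall : ∀ i, 0 < z i
      · exact ⟨z, hall, h2⟩
      · push Not at hall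
        obtain ⟨i, hi⟩ := hall
        obtain ⟨s, hs⟩ := h1
        obtain ⟨v, u, hv, hu, hvu⟩ := exists_boundary (fun a b => G a b ≠ 0) {x | z x ≠ 0} i s hs
          (by simp; omega) (hc i s)
        simp only [Set.mem_setOf_eq, not_not] at hv hu
        apply ih (fun x => 2 * z x + if x = v then 1 else 0)
        · exact ⟨v, by simp⟩
        · intro x
          have e : ∑ j, G x j * (2 * z j + if j = v then 1 else 0) =
              2 * ∑ j, G x j * z j + G x v := by
            simp only [mul_add, Finset.sum_add_distrib, Finset.mul_sum]
            congr 1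
            · exact Finset.sum_congr rfl fun j _ => by ring
            · simp
          rw [e]
          by_cases hx : x = v
          · subst hx
            have : G x u * z u ≤ ∑ j, G x j * z j :=
              Finset.single_le_sum (f := fun j => G x j * z j) (fun _ _ => Nat.zero_le _)
                (Finset.mem_univ u)
            have : 1 ≤ G x u * z u := Nat.mul_pos (Nat.pos_of_ne_zero hvu) (Nat.pos_of_ne_zero hu)
            simp [hv]; omega
          · have := h2 x
            simp [hx]; omega
        · have hlt : (Finset.univ.filter fun i => 2 * z i + (if i = v then 1 else 0) = 0).card <
              (Finset.univ.filter fun i => z i = 0).card := by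
            apply Finset.card_lt_card
            rw [Finset.ssubset_iff_of_subset]
            · exact ⟨v, by simp [hv], by simp⟩
            · intro x hx
              simp only [Finset.mem_filter, Finset.mem_univ, true_and] at hx ⊢
              omega
          omega
  obtain ⟨z, h1, h2⟩ := h
  exact main _ z h1 h2 le_rfl

/-- Adjacency on a path. -/
def armG (i j : ℕ) : ℕ := if i + 1 = j ∨ j + 1 = i then 1 else 0

/-- Vertices of a star with three arms. -/
abbrev StarV (p q r : ℕ) : Type := Fin p ⊕ Fin q ⊕ Fin r ⊕ Unit

/-- Adjacency in a star with three arms. -/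
def starG (p q r : ℕ) : StarV p q r → StarV p q r → ℕ
  | .inl i, .inl j => armG i j
  | .inl i, .inr (.inr (.inr _)) => if (i : ℕ) = 0 then 1 else 0
  | .inr (.inr (.inr _)), .inl i => if (i : ℕ) = 0 then 1 else 0
  | .inr (.inl i), .inr (.inl j) => armG i j
  | .inr (.inl i), .inr (.inr (.inr _)) => if (i : ℕ) = 0 then 1 else 0
  | .inr (.inr (.inr _)), .inr (.inl i) => if (i : ℕ) = 0 then 1 else 0
  | .inr (.inr (.inl i)), .inr (.inr (.inl j)) => armG i j
  | .inr (.inr (.inl i)), .inr (.inr (.inr _)) => if (i : ℕ) = 0 then 1 else 0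
  | .inr (.inr (.inr _)), .inr (.inr (.inl i)) => if (i : ℕ) = 0 then 1 else 0
  | _, _ => 0

/-- A star with three arms inside a graph. -/
structure Star {V : Type} (E : V → V → ℕ) (o : V) (a b c : ℕ → V) (p q r : ℕ) : Prop where
  ao : ∀ i < p, a i ≠ o
  bo : ∀ i < q, b i ≠ o
  co : ∀ i < r, c i ≠ o
  ai : ∀ i < p, ∀ j < p, a i = a j → i = j
  bi : ∀ i < q, ∀ j < q, b i = b j → i = j
  ci : ∀ i < r, ∀ j < r, c i = c j → i = j
  ab : ∀ i < p, ∀ j < q, a i ≠ b j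
  ac : ∀ i < p, ∀ j < r, a i ≠ c j
  bc : ∀ i < q, ∀ j < r, b i ≠ c j
  ea0 : 0 < p → E o (a 0) ≠ 0
  eb0 : 0 < q → E o (b 0) ≠ 0
  ec0 : 0 < r → E o (c 0) ≠ 0
  ea : ∀ i, i + 1 < p → E (a i) (a (i + 1)) ≠ 0
  eb : ∀ i, i + 1 < q → E (b i) (b (i + 1)) ≠ 0
  ec : ∀ i, i + 1 < r → E (c i) (c (i + 1)) ≠ 0

theorem Star.swap12 {V : Type} {E : V → V → ℕ} {o : V} {a b c : ℕ → V} {p q r : ℕ}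
    (h : Star E o a b c p q r) : Star E o b a c q p r :=
  ⟨h.bo, h.ao, h.co, h.bi, h.ai, h.ci, fun i hi j hj => (h.ab j hj i hi).symm, h.bc, h.ac,
    h.eb0, h.ea0, h.ec0, h.eb, h.ea, h.ec⟩

theorem Star.swap23 {V : Type} {E : V → V → ℕ} {o : V} {a b c : ℕ → V} {p q r : ℕ}
    (h : Star E o a b c p q r) : Star E o a c b p r q :=
  ⟨h.ao, h.co, h.bo, h.ai, h.ci, h.bi, h.ac, h.ab, fun i hi j hj => (h.bc j hj i hi).symm,
    h.ea0, h.ec0, h.eb0, h.ea, h.ec, h.eb⟩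

theorem Star.mono {V : Type} {E : V → V → ℕ} {o : V} {a b c : ℕ → V} {p q r p' q' r' : ℕ}
    (h : Star E o a b c p q r) (hp : p' ≤ p) (hq : q' ≤ q) (hr : r' ≤ r) :
    Star E o a b c p' q' r' where
  ao i hi := h.ao i (by omega)
  bo i hi := h.bo i (by omega)
  co i hi := h.co i (by omega)
  ai i hi j hj := h.ai i (by omega) j (by omega)
  bi i hi j hj := h.bi i (by omega) j (by omega)
  ci i hi j hj := h.ci i (by omega) j (by omega)
  ab i hi j hj := h.ab i (by omega) j (by omega)
  ac i hi j hj := h.ac i (by omega) j (by omega)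
  bc i hi j hj := h.bc i (by omega) j (by omega)
  ea0 h0 := h.ea0 (by omega)
  eb0 h0 := h.eb0 (by omega)
  ec0 h0 := h.ec0 (by omega)
  ea i hi := h.ea i (by omega)
  eb i hi := h.eb i (by omega)
  ec i hi := h.ec i (by omega)

/-- The vertex map of a star. -/
def starMap {V : Type} (o : V) (a b c : ℕ → V) (p q r : ℕ) : StarV p q r → V
  | .inl i => a i
  | .inr (.inl i) => b i
  | .inr (.inr (.inl i)) => c i
  | .inr (.inr (.inr _)) => o

theorem Star.inj {V : Type} {E : V → V → ℕ} {o : V} {a b c : ℕ → V} {p q r : ℕ}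
    (h : Star E o a b c p q r) : Function.Injective (starMap o a b c p q r) := by
  rintro (⟨i, hi⟩ | ⟨i, hi⟩ | ⟨i, hi⟩ | i) (⟨j, hj⟩ | ⟨j, hj⟩ | ⟨j, hj⟩ | j) e <;>
    simp only [starMap] at e
  · simp [h.ai i hi j hj e]
  · exact absurd e (h.ab i hi j hj)
  · exact absurd e (h.ac i hi j hj)
  · exact absurd e (h.ao i hi)
  · exact absurd e.symm (h.ab j hj i hi)
  · simp [h.bi i hi j hj e]
  · exact absurd e (h.bc i hi j hj)
  · exact absurd e (h.bo i hi)
  · exact absurd e.symm (h.ac j hj i hi)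
  · exact absurd e.symm (h.bc j hj i hi)
  · simp [h.ci i hi j hj e]
  · exact absurd e (h.co i hi)
  · exact absurd e.symm (h.ao j hj)
  · exact absurd e.symm (h.bo j hj)
  · exact absurd e.symm (h.co j hj)
  · rfl

theorem armG_le {V : Type} {E : V → V → ℕ} (hs : ∀ x y, E x y = E y x) {a : ℕ → V} {p : ℕ}
    (h : ∀ i, i + 1 < p → E (a i) (a (i + 1)) ≠ 0) (i j : ℕ) (hi : i < p) (hj : j < p) :
    armG i j ≤ E (a i) (a j) := by
  unfold armG
  split
  · rename_i hh
    rcases hh with hh | hh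
    · subst hh; exact Nat.one_le_iff_ne_zero.mpr (h i hj)
    · subst hh; rw [hs]; exact Nat.one_le_iff_ne_zero.mpr (h j hi)
  · exact Nat.zero_le _

theorem endG_le {V : Type} {E : V → V → ℕ} {a : ℕ → V} {o : V} {p : ℕ}
    (h : 0 < p → E o (a 0) ≠ 0) (i : ℕ) (hi : i < p) :
    (if i = 0 then 1 else 0) ≤ E o (a i) := by
  split
  · rename_i hh; subst hh; exact Nat.one_le_iff_ne_zero.mpr (h hi)
  · exact Nat.zero_le _

theorem Star.le {V : Type} {E : V → V → ℕ} {o : V} {a b c : ℕ → V} {p q r : ℕ}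
    (hs : ∀ x y, E x y = E y x) (h : Star E o a b c p q r) (s t : StarV p q r) :
    starG p q r s t ≤ E (starMap o a b c p q r s) (starMap o a b c p q r t) := by
  rcases s with ⟨i, hi⟩ | ⟨i, hi⟩ | ⟨i, hi⟩ | i <;>
    rcases t with ⟨j, hj⟩ | ⟨j, hj⟩ | ⟨j, hj⟩ | j <;>
    simp only [starMap, starG] <;> try exact Nat.zero_le _
  · exact armG_le hs h.ea i j hi hj
  · rw [hs]; exact endG_le h.ea0 i hi
  · exact armG_le hs h.eb i j hi hj
  · rw [hs]; exact endG_le h.eb0 i hi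
  · exact armG_le hs h.ec i j hi hj
  · rw [hs]; exact endG_le h.ec0 i hi
  · exact endG_le h.ea0 j hj
  · exact endG_le h.eb0 j hj
  · exact endG_le h.ec0 j hj

theorem hasZ_E6 : HasZ (starG 2 2 2) :=
  ⟨fun | .inl i => ![2, 1] i | .inr (.inl i) => ![2, 1] i | .inr (.inr (.inl i)) => ![2, 1] i
       | .inr (.inr (.inr _)) => 3, ⟨.inr (.inr (.inr ())), by decide⟩, by decide⟩

theorem hasZ_E7 : HasZ (starG 3 3 1) :=
  ⟨fun | .inl i => ![3, 2, 1] i | .inr (.inl i) => ![3, 2, 1] i | .inr (.inr (.inl _)) => 2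
       | .inr (.inr (.inr _)) => 4, ⟨.inr (.inr (.inr ())), by decide⟩, by decide⟩

theorem hasZ_E8 : HasZ (starG 5 2 1) :=
  ⟨fun | .inl i => ![5, 4, 3, 2, 1] i | .inr (.inl i) => ![4, 2] i | .inr (.inr (.inl _)) => 3
       | .inr (.inr (.inr _)) => 6, ⟨.inr (.inr (.inr ())), by decide⟩, by decide⟩

/-- The extended diagram of type `D`. -/
def dtG (s : ℕ) : Fin 4 ⊕ Fin (s + 1) → Fin 4 ⊕ Fin (s + 1) → ℕ
  | .inl x, .inr j => if (x : ℕ) < 2 then (if (j : ℕ) = 0 then 1 else 0)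
      else (if (j : ℕ) = s then 1 else 0)
  | .inr j, .inl x => if (x : ℕ) < 2 then (if (j : ℕ) = 0 then 1 else 0)
      else (if (j : ℕ) = s then 1 else 0)
  | .inr i, .inr j => armG i j
  | .inl _, .inl _ => 0

theorem hasZ_dt (s : ℕ) : HasZ (dtG s) := by
  refine ⟨fun | .inl _ => 1 | .inr _ => 2, ⟨.inl 0, by simp⟩, ?_⟩
  rintro (x | i)
  · rw [Fintype.sum_sum_type]
    have key : ∀ j : Fin (s + 1), (if (x : ℕ) < 2 then (if (j : ℕ) = 0 then 1 else 0)
      else (if (j : ℕ) = s then 1 else 0)) = 1 →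
        2 ≤ ∑ j : Fin (s + 1), dtG s (.inl x) (.inr j) * 2 := by
      intro j hj
      have := Finset.single_le_sum (f := fun j : Fin (s + 1) => dtG s (.inl x) (.inr j) * 2)
        (fun _ _ => Nat.zero_le _) (Finset.mem_univ j)
      simp only [dtG] at this
      rw [hj] at this
      simpa only [dtG] using this
    have : 2 ≤ ∑ j : Fin (s + 1), dtG s (.inl x) (.inr j) * 2 := by
      by_cases hx : (x : ℕ) < 2
      · exact key 0 (by simp [hx])
      · exact key (Fin.last s) (by simp [hx])
    simp only
    omega
  · rw [Fintype.sum_sum_type]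
    have h1 : ∑ x : Fin 4, dtG s (.inr i) (.inl x) * 1 =
        2 * (if (i : ℕ) = 0 then 1 else 0) + 2 * (if (i : ℕ) = s then 1 else 0) := by
      simp [Fin.sum_univ_four, dtG]
      split_ifs <;> rfl
    have h2 : 2 * (if (i : ℕ) = 0 then 0 else 1) + 2 * (if (i : ℕ) = s then 0 else 1) ≤
        ∑ j : Fin (s + 1), dtG s (.inr i) (.inr j) * 2 := by
      have hsingle : ∀ j : Fin (s + 1), armG i j * 2 ≤
          ∑ j : Fin (s + 1), dtG s (.inr i) (.inr j) * 2 := fun j =>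
        Finset.single_le_sum (f := fun j : Fin (s + 1) => dtG s (.inr i) (.inr j) * 2)
        (fun _ _ => Nat.zero_le _) (Finset.mem_univ j)
      have hpair : ∀ j j' : Fin (s + 1), j ≠ j' → armG i j * 2 + armG i j' * 2 ≤
          ∑ j : Fin (s + 1), dtG s (.inr i) (.inr j) * 2 := by
        intro j j' hjj
        have := Finset.sum_le_sum_of_subset
          (f := fun j : Fin (s + 1) => dtG s (.inr i) (.inr j) * 2)
          (Finset.subset_univ {j, j'})
        rw [Finset.sum_pair hjj] at this
        exact this
      have hi := i.2
      by_cases c0 : (i : ℕ) = 0 <;> by_cases c1 : (i : ℕ) = s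
      · rw [if_pos c0, if_pos c1]; exact Nat.zero_le _
      · rw [if_pos c0, if_neg c1]
        have := hsingle ⟨i + 1, by omega⟩
        simpa [armG] using this
      · rw [if_neg c0, if_pos c1]
        have := hsingle ⟨i - 1, by omega⟩
        have e : armG i (i - 1 : ℕ) = 1 := by unfold armG; rw [if_pos]; omega
        simp only [e] at this
        simpa using this
      · rw [if_neg c0, if_neg c1]
        have := hpair ⟨i - 1, by omega⟩ ⟨i + 1, by omega⟩ (by simp [Fin.ext_iff])
        have e : armG i (i - 1 : ℕ) = 1 := by unfold armG; rw [if_pos]; omega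
        have e' : armG i (i + 1 : ℕ) = 1 := by unfold armG; rw [if_pos]; omega
        simp only [e, e'] at this
        simpa using this
    have h3 : (if (i : ℕ) = 0 then 1 else 0) + (if (i : ℕ) = 0 then 0 else 1) = 1 := by
      split <;> rfl
    have h4 : (if (i : ℕ) = s then 1 else 0) + (if (i : ℕ) = s then 0 else 1) = 1 := by
      split <;> rfl
    simp only
    omega

/-- The spine of an arm: center followed by the arm. -/
def spine {V : Type} (o : V) (a : ℕ → V) : ℕ → V
  | 0 => o
  | s + 1 => a s

theorem Star.inner {V : Type} [Fintype V] {E : V → V → ℕ} {o : V} {a b c : ℕ → V} {p q r : ℕ}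
    (hs : ∀ x y, E x y = E y x) (h : Star E o a b c p q r) (hq : 0 < q) (hr : 0 < r)
    (v : V) (hva : ∀ i < p, v ≠ a i) (hvb : ∀ i < q, v ≠ b i) (hvc : ∀ i < r, v ≠ c i)
    (hvo : v ≠ o) (s : ℕ) (hsp : s < p) (hv : E v (spine o a s) ≠ 0) : HasZ E := by
  have hsb : ∀ j ≤ p, spine o a j ≠ b 0 := by
    rintro (_ | j) hj
    · exact (h.bo 0 hq).symm
    · exact h.ab j (by omega) 0 hq
  have hsc : ∀ j ≤ p, spine o a j ≠ c 0 := by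
    rintro (_ | j) hj
    · exact (h.co 0 hr).symm
    · exact h.ac j (by omega) 0 hr
  have hsv : ∀ j ≤ p, spine o a j ≠ v := by
    rintro (_ | j) hj
    · exact hvo.symm
    · exact (hva j (by omega)).symm
  have hss : ∀ i ≤ p, ∀ j ≤ p, spine o a i = spine o a j → i = j := by
    rintro (_ | i) hi (_ | j) hj e
    · rfl
    · exact absurd e.symm (h.ao j (by omega))
    · exact absurd e (h.ao i (by omega))
    · rw [h.ai i (by omega) j (by omega) e]
  have hse : ∀ i, i + 1 < p + 1 → E (spine o a i) (spine o a (i + 1)) ≠ 0 := by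
    rintro (_ | i) hi
    · exact h.ea0 (by omega)
    · exact h.ea i (by omega)
  have hbc := h.bc 0 hq 0 hr
  have hbv := hvb 0 hq
  have hcv := hvc 0 hr
  refine hasZ_emb (dtG s) E (fun
    | .inl x => ![b 0, c 0, v, spine o a (s + 1)] x
    | .inr j => spine o a j) ?_ ?_ (hasZ_dt s)
  · have h0 := hsb (s + 1) (by omega)
    have h1 := hsc (s + 1) (by omega)
    have h2 := hsv (s + 1) (by omega)
    have hmix : ∀ (x : Fin 4) (j : Fin (s + 1)),
        (![b 0, c 0, v, spine o a (s + 1)] : Fin 4 → V) x ≠ spine o a j := by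
      intro x j
      have hj := j.2
      fin_cases x
      · exact (hsb j (by omega)).symm
      · exact (hsc j (by omega)).symm
      · exact (hsv j (by omega)).symm
      · intro e
        have := hss (s + 1) (by omega) j (by omega) e
        omega
    rintro (x | i) (y | j) e
    · simp only at e
      congr 1
      fin_cases x <;> fin_cases y <;> simp at e ⊢ <;>
        first
          | exact absurd e hbc
          | exact absurd e.symm hbc
          | exact absurd e hbv
          | exact absurd e.symm hbv
          | exact absurd e hcv
          | exact absurd e.symm hcv
          | exact absurd e h0
          | exact absurd e.symm h0
          | exact absurd e h1
          | exact absurd e.symm h1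
          | exact absurd e h2
          | exact absurd e.symm h2
    · exact absurd e (hmix x j)
    · exact absurd e.symm (hmix y i)
    · have hi := i.2
      have hj := j.2
      have := hss i (by omega) j (by omega) e
      congr 1
      exact Fin.ext this
  · have hmix : ∀ (x : Fin 4) (j : Fin (s + 1)), dtG s (.inl x) (.inr j) ≤
        E ((![b 0, c 0, v, spine o a (s + 1)] : Fin 4 → V) x) (spine o a j) := by
      intro x j
      have hbz : E (b 0) o ≠ 0 := by rw [hs]; exact h.eb0 hq
      have hcz : E (c 0) o ≠ 0 := by rw [hs]; exact h.ec0 hr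
      have haz : E (spine o a (s + 1)) (spine o a s) ≠ 0 := by rw [hs]; exact hse s (by omega)
      simp only [dtG]
      fin_cases x <;> simp <;> split <;> try exact Nat.zero_le _
      · rename_i hj; rw [hj]; exact Nat.one_le_iff_ne_zero.mpr hbz
      · rename_i hj; rw [hj]; exact Nat.one_le_iff_ne_zero.mpr hcz
      · rename_i hj; rw [hj]; exact Nat.one_le_iff_ne_zero.mpr hv
      · rename_i hj; rw [hj]; exact Nat.one_le_iff_ne_zero.mpr haz
    rintro (x | i) (y | j)
    · exact Nat.zero_le _
    · exact hmix x j
    · have := hmix y i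
      rw [hs]
      exact this
    · have hi := i.2
      have hj := j.2
      exact armG_le hs hse i j (by omega) (by omega)

theorem Star.extend {V : Type} {E : V → V → ℕ} {o : V} {a b c : ℕ → V} {p q r : ℕ}
    (hs : ∀ x y, E x y = E y x) (h : Star E o a b c p q r)
    (v : V) (hva : ∀ i < p, v ≠ a i) (hvb : ∀ i < q, v ≠ b i) (hvc : ∀ i < r, v ≠ c i)
    (hvo : v ≠ o) (hv : E v (spine o a p) ≠ 0) :
    Star E o (Function.update a p v) b c (p + 1) q r := by
  have hu : ∀ i, i < p → Function.update a p v i = a i := fun i hi => by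
    rw [Function.update_of_ne (by omega)]
  have hp : Function.update a p v p = v := Function.update_self ..
  have hsplit : ∀ i, i < p + 1 → (i < p ∨ i = p) := fun i hi => by omega
  constructor
  · intro i hi
    rcases hsplit i hi with hi | rfl
    · rw [hu i hi]; exact h.ao i hi
    · rw [hp]; exact hvo
  · exact h.bo
  · exact h.co
  · intro i hi j hj e
    rcases hsplit i hi with hi | rfl <;> rcases hsplit j hj with hj | rfl
    · rw [hu i hi, hu j hj] at e; exact h.ai i hi j hj e
    · rw [hu i hi, hp] at e; exact absurd e.symm (hva i hi)
    · rw [hu j hj, hp] at e; exact absurd e (hva j hj)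
    · rfl
  · exact h.bi
  · exact h.ci
  · intro i hi j hj
    rcases hsplit i hi with hi | rfl
    · rw [hu i hi]; exact h.ab i hi j hj
    · rw [hp]; exact hvb j hj
  · intro i hi j hj
    rcases hsplit i hi with hi | rfl
    · rw [hu i hi]; exact h.ac i hi j hj
    · rw [hp]; exact hvc j hj
  · exact h.bc
  · intro _
    rcases Nat.eq_zero_or_pos p with rfl | hp0
    · rw [hp, hs]; exact hv
    · rw [hu 0 hp0]; exact h.ea0 hp0
  · exact h.eb0
  · exact h.ec0
  · intro i hi
    rcases hsplit (i + 1) hi with hi' | hi'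
    · rw [hu i (by omega), hu (i + 1) hi']; exact h.ea i hi'
    · rw [hi', hp, hu i (by omega), hs]
      rw [← hi'] at hv
      exact hv
  · exact h.eb
  · exact h.ec

theorem Star.step {V : Type} [Fintype V] {E : V → V → ℕ} {o : V} {a b c : ℕ → V} {p q r : ℕ}
    (hs : ∀ x y, E x y = E y x) (hno : ¬ HasZ E) (h : Star E o a b c p q r)
    (hq : 0 < q) (hr : 0 < r)
    (v : V) (hva : ∀ i < p, v ≠ a i) (hvb : ∀ i < q, v ≠ b i) (hvc : ∀ i < r, v ≠ c i)
    (hvo : v ≠ o) (i : ℕ) (hi : i < p) (hv : E v (a i) ≠ 0) :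
    ∃ a', Star E o a' b c (p + 1) q r := by
  by_cases hip : i + 1 < p
  · exact absurd (h.inner hs hq hr v hva hvb hvc hvo (i + 1) hip hv) hno
  · have : p = i + 1 := by omega
    subst this
    exact ⟨_, h.extend hs v hva hvb hvc hvo hv⟩

/-- The star covers all vertices. -/
def StarCov {V : Type} (o : V) (a b c : ℕ → V) (p q r : ℕ) : Prop :=
  ∀ v, v = o ∨ (∃ i < p, v = a i) ∨ (∃ i < q, v = b i) ∨ (∃ i < r, v = c i)

theorem star_grow {V : Type} [Fintype V] {E : V → V → ℕ} {o : V}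
    (hs : ∀ x y, E x y = E y x) (hno : ¬ HasZ E)
    (hc : ∀ x y, Relation.ReflTransGen (fun u v => E u v ≠ 0) x y) (d : ℕ) :
    ∀ (a b c : ℕ → V) (p q r : ℕ), 0 < p → 0 < q → 0 < r → Star E o a b c p q r →
      Fintype.card V ≤ p + q + r + d →
      ∃ (a b c : ℕ → V) (p q r : ℕ), 0 < p ∧ 0 < q ∧ 0 < r ∧ Star E o a b c p q r ∧
        StarCov o a b c p q r := by
  induction d with
  | zero =>
    intro a b c p q r _ _ _ h hd
    have := Fintype.card_le_of_injective _ h.inj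
    simp at this
    omega
  | succ d ih =>
    intro a b c p q r hp hq hr h hd
    by_cases hcov : StarCov o a b c p q r
    · exact ⟨a, b, c, p, q, r, hp, hq, hr, h, hcov⟩
    · unfold StarCov at hcov
      rw [not_forall] at hcov
      obtain ⟨v0, hv0⟩ := hcov
      obtain ⟨v, u, hv, hu, hvu⟩ := exists_boundary (fun u v => E u v ≠ 0)
        {v | v = o ∨ (∃ i < p, v = a i) ∨ (∃ i < q, v = b i) ∨ (∃ i < r, v = c i)}
        v0 o (Or.inl rfl) hv0 (hc _ _)
      simp only [Set.mem_ofPred_eq, not_or, not_exists, not_and] at hv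
      obtain ⟨hvo, hva, hvb, hvc⟩ := hv
      rcases hu with rfl | ⟨i, hi, rfl⟩ | ⟨i, hi, rfl⟩ | ⟨i, hi, rfl⟩
      · exact absurd (h.inner hs hq hr v hva hvb hvc hvo 0 hp hvu) hno
      · obtain ⟨a', h'⟩ := h.step hs hno hq hr v hva hvb hvc hvo i hi hvu
        exact ih a' b c (p + 1) q r (by omega) hq hr h' (by omega)
      · obtain ⟨a', h'⟩ := h.swap12.step hs hno hp hr v hvb hva hvc hvo i hi hvu
        exact ih a a' c p (q + 1) r hp (by omega) hr h'.swap12 (by omega)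
      · obtain ⟨a', h'⟩ := h.swap23.swap12.step hs hno hp hq v hvc hva hvb hvo i hi hvu
        exact ih a b a' p q (r + 1) hp hq (by omega) h'.swap12.swap23 (by omega)

theorem starG_symm (p q r : ℕ) (s t : StarV p q r) : starG p q r s t = starG p q r t s := by
  rcases s with i | i | i | i <;> rcases t with j | j | j | j <;> simp only [starG] <;>
    (unfold armG; split_ifs <;> omega)

theorem starG_conn (p q r : ℕ) (s : StarV p q r) :
    Relation.ReflTransGen (fun a b => starG p q r a b ≠ 0) s (.inr (.inr (.inr ()))) := by
  rcases s with ⟨i, hi⟩ | ⟨i, hi⟩ | ⟨i, hi⟩ | i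
  · induction i with
    | zero => exact Relation.ReflTransGen.single (by simp [starG])
    | succ i ih =>
      exact Relation.ReflTransGen.head (b := .inl ⟨i, by omega⟩) (by simp [starG, armG])
        (ih (by omega))
  · induction i with
    | zero => exact Relation.ReflTransGen.single (by simp [starG])
    | succ i ih =>
      exact Relation.ReflTransGen.head (b := .inr (.inl ⟨i, by omega⟩)) (by simp [starG, armG])
        (ih (by omega))
  · induction i with
    | zero => exact Relation.ReflTransGen.single (by simp [starG])
    | succ i ih =>
      exact Relation.ReflTransGen.head (b := .inr (.inr (.inl ⟨i, by omega⟩)))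
        (by simp [starG, armG]) (ih (by omega))
  · exact Relation.ReflTransGen.refl

theorem dyn_of_label {ι : Type} [Fintype ι] {n : ℕ} (E D : Fin n → Fin n → ℕ) (ψ : ι → Fin n)
    (hψ : Function.Bijective ψ) (lab : ι → Fin n) (hlab : Function.Injective lab)
    (h : ∀ s t, E (ψ s) (ψ t) = D (lab s) (lab t)) :
    ∃ e : Fin n ≃ Fin n, ∀ i j, E i j = D (e i) (e j) := by
  have hb : Function.Bijective lab :=
    (Fintype.bijective_iff_injective_and_card lab).mpr ⟨hlab, Fintype.card_of_bijective hψ⟩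
  refine ⟨(Equiv.ofBijective ψ hψ).symm.trans (Equiv.ofBijective lab hb), fun i j => ?_⟩
  obtain ⟨s, rfl⟩ := hψ.2 i
  obtain ⟨t, rfl⟩ := hψ.2 j
  rw [h]
  have e : ∀ s, (Equiv.ofBijective ψ hψ).symm (ψ s) = s := fun s =>
    Equiv.ofBijective_symm_apply_apply ψ hψ s
  simp [e]

theorem ite_congr_nat {P Q : Prop} [Decidable P] [Decidable Q] (h : P ↔ Q) :
    (if P then 1 else 0 : ℕ) = if Q then 1 else 0 := by
  by_cases hP : P
  · rw [if_pos hP, if_pos (h.mp hP)]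
  · rw [if_neg hP, if_neg (fun hQ => hP (h.mpr hQ))]

/-- Labels for type `D`. -/
def labD (p : ℕ) : StarV p 1 1 → Fin (p + 1 + 1 + 1)
  | .inl i => ⟨i + 3, by omega⟩
  | .inr (.inl _) => ⟨0, by omega⟩
  | .inr (.inr (.inl _)) => ⟨1, by omega⟩
  | .inr (.inr (.inr _)) => ⟨2, by omega⟩

theorem labD_inj (p : ℕ) : Function.Injective (labD p) := by
  rintro (⟨i, hi⟩ | ⟨i, hi⟩ | ⟨i, hi⟩ | i) (⟨j, hj⟩ | ⟨j, hj⟩ | ⟨j, hj⟩ | j) e <;>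
    simp [labD] at e ⊢ <;> omega

theorem labD_edge (p : ℕ) (s t : StarV p 1 1) :
    starG p 1 1 s t = edgeD (p + 1 + 1 + 1) (labD p s) (labD p t) := by
  rcases s with ⟨i, hi⟩ | ⟨i, hi⟩ | ⟨i, hi⟩ | i <;>
    rcases t with ⟨j, hj⟩ | ⟨j, hj⟩ | ⟨j, hj⟩ | j <;>
    simp only [starG, armG, edgeD, labD] <;>
    first
      | exact ite_congr_nat (by omega)
      | exact (if_neg (by omega)).symm
      | (simp; omega)

/-- Labels for type `E`. -/
def labE (p : ℕ) : StarV p 2 1 → Fin (p + 2 + 1 + 1)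
  | .inl i => ⟨i + 3, by omega⟩
  | .inr (.inl i) => ⟨1 - i, by omega⟩
  | .inr (.inr (.inl _)) => ⟨p + 3, by omega⟩
  | .inr (.inr (.inr _)) => ⟨2, by omega⟩

theorem labE_inj (p : ℕ) : Function.Injective (labE p) := by
  rintro (⟨i, hi⟩ | ⟨i, hi⟩ | ⟨i, hi⟩ | i) (⟨j, hj⟩ | ⟨j, hj⟩ | ⟨j, hj⟩ | j) e <;>
    simp [labE] at e ⊢ <;> omega

theorem labE_edge (p : ℕ) (hp : 0 < p) (s t : StarV p 2 1) :
    starG p 2 1 s t = edgeE (p + 2 + 1 + 1) (labE p s) (labE p t) := by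
  rcases s with ⟨i, hi⟩ | ⟨i, hi⟩ | ⟨i, hi⟩ | i <;>
    rcases t with ⟨j, hj⟩ | ⟨j, hj⟩ | ⟨j, hj⟩ | j <;>
    simp only [starG, armG, edgeE, labE] <;>
    first
      | exact ite_congr_nat (by omega)
      | exact (if_neg (by omega)).symm
      | (simp; omega)

theorem star_sorted {n : ℕ} {E : Fin n → Fin n → ℕ} {o : Fin n}
    (hs : ∀ x y, E x y = E y x) (h0 : ∀ x, E x x = 0) (hno : ¬ HasZ E)
    (a b c : ℕ → Fin n) (p q r : ℕ) (hr : 0 < r) (hrq : r ≤ q) (hqp : q ≤ p)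
    (h : Star E o a b c p q r) (hcov : StarCov o a b c p q r) : IsDynkinADE n E := by
  have sub : ∀ p' q' r', p' ≤ p → q' ≤ q → r' ≤ r → ¬ HasZ (starG p' q' r') := by
    intro p' q' r' hp hq hr hz
    have h' := h.mono hp hq hr
    exact hno (hasZ_emb _ E _ h'.inj (h'.le hs) hz)
  have hr1 : r = 1 := by
    by_contra hne
    exact sub 2 2 2 (by omega) (by omega) (by omega) hasZ_E6
  subst hr1
  have hq2 : q ≤ 2 := by
    by_contra hne
    exact sub 3 3 1 (by omega) (by omega) (by omega) hasZ_E7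
  have hbij : Function.Bijective (starMap o a b c p q 1) := by
    refine ⟨h.inj, fun v => ?_⟩
    rcases hcov v with rfl | ⟨i, hi, rfl⟩ | ⟨i, hi, rfl⟩ | ⟨i, hi, rfl⟩
    · exact ⟨.inr (.inr (.inr ())), rfl⟩
    · exact ⟨.inl ⟨i, hi⟩, rfl⟩
    · exact ⟨.inr (.inl ⟨i, hi⟩), rfl⟩
    · exact ⟨.inr (.inr (.inl ⟨i, hi⟩)), rfl⟩
  have hcard : n = p + q + 1 + 1 := by
    have := Fintype.card_of_bijective hbij
    simp at this
    omega
  have hex := exact_of_ge (starG p q 1)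
    (fun s t => E (starMap o a b c p q 1 s) (starMap o a b c p q 1 t))
    (fun _ _ => hs _ _) (fun _ => h0 _) (starG_symm p q 1) _ (starG_conn p q 1) (h.le hs)
    (fun hz => hno (hasZ_emb _ E _ h.inj (fun _ _ => le_refl _) hz))
  subst hcard
  rcases (show q = 1 ∨ q = 2 by omega) with rfl | rfl
  · obtain ⟨e, he⟩ := dyn_of_label E (edgeD _) _ hbij (labD p) (labD_inj p)
      (fun s t => (hex s t).trans (labD_edge p s t))
    exact ⟨e, Or.inr (Or.inl ⟨by omega, he⟩)⟩
  · have hp5 : p < 5 := by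
      by_contra hne
      exact sub 5 2 1 (by omega) (by omega) (by omega) hasZ_E8
    obtain ⟨e, he⟩ := dyn_of_label E (edgeE _) _ hbij (labE p) (labE_inj p)
      (fun s t => (hex s t).trans (labE_edge p (by omega) s t))
    exact ⟨e, Or.inr (Or.inr ⟨by omega, he⟩)⟩

theorem star_dynkin {n : ℕ} {E : Fin n → Fin n → ℕ} {o : Fin n}
    (hs : ∀ x y, E x y = E y x) (h0 : ∀ x, E x x = 0) (hno : ¬ HasZ E)
    (a b c : ℕ → Fin n) (p q r : ℕ) (hp : 0 < p) (hq : 0 < q) (hr : 0 < r)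
    (h : Star E o a b c p q r) (hcov : StarCov o a b c p q r) : IsDynkinADE n E := by
  have c12 : ∀ {a b c : ℕ → Fin n} {p q r : ℕ}, StarCov o a b c p q r →
      StarCov o b a c q p r := by
    intro a b c p q r hc v
    rcases hc v with h | h | h | h
    · exact Or.inl h
    · exact Or.inr (Or.inr (Or.inl h))
    · exact Or.inr (Or.inl h)
    · exact Or.inr (Or.inr (Or.inr h))
  have c23 : ∀ {a b c : ℕ → Fin n} {p q r : ℕ}, StarCov o a b c p q r →
      StarCov o a c b p r q := by
    intro a b c p q r hc v
    rcases hc v with h | h | h | h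
    · exact Or.inl h
    · exact Or.inr (Or.inl h)
    · exact Or.inr (Or.inr (Or.inr h))
    · exact Or.inr (Or.inr (Or.inl h))
  rcases le_total q p with h1 | h1 <;> rcases le_total r q with h2 | h2 <;>
    rcases le_total r p with h3 | h3
  · exact star_sorted hs h0 hno a b c p q r hr h2 h1 h hcov
  · exact star_sorted hs h0 hno a b c p q r hr h2 h1 h hcov
  · exact star_sorted hs h0 hno _ _ _ _ _ _ hq h2 h3 h.swap23 (c23 hcov)
  · exact star_sorted hs h0 hno _ _ _ _ _ _ hq h1 h3 h.swap23.swap12 (c12 (c23 hcov))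
  · exact star_sorted hs h0 hno _ _ _ _ _ _ hr h3 h1 h.swap12 (c12 hcov)
  · exact star_sorted hs h0 hno _ _ _ _ _ _ hp h3 h2 h.swap12.swap23 (c23 (c12 hcov))
  · exact star_sorted hs h0 hno _ _ _ _ _ _ hp h1 h2 h.swap12.swap23.swap12
      (c12 (c23 (c12 hcov)))
  · exact star_sorted hs h0 hno _ _ _ _ _ _ hp h1 h2 h.swap12.swap23.swap12
      (c12 (c23 (c12 hcov)))

/-- An injective path of `m` vertices. -/
structure IsPth {V : Type} (E : V → V → ℕ) (a : ℕ → V) (m : ℕ) : Prop where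
  inj : ∀ i < m, ∀ j < m, a i = a j → i = j
  edge : ∀ i, i + 1 < m → E (a i) (a (i + 1)) ≠ 0

theorem path_grow {V : Type} [Fintype V] {E : V → V → ℕ}
    (hs : ∀ x y, E x y = E y x)
    (hc : ∀ x y, Relation.ReflTransGen (fun u v => E u v ≠ 0) x y)
    (hst : ∀ o a b c, ¬ Star E o a b c 1 1 1) (d : ℕ) :
    ∀ (a : ℕ → V) (m : ℕ), 0 < m → IsPth E a m → Fintype.card V < m + d →
      ∃ (a : ℕ → V) (m : ℕ), 0 < m ∧ IsPth E a m ∧ ∀ v, ∃ i < m, v = a i := by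
  induction d with
  | zero =>
    intro a m _ h hd
    have := Fintype.card_le_of_injective (fun i : Fin m => a i)
      (fun i j e => Fin.ext (h.inj i i.2 j j.2 e))
    simp at this
    omega
  | succ d ih =>
    intro a m hm h hd
    by_cases hcov : ∀ v, ∃ i < m, v = a i
    · exact ⟨a, m, hm, h, hcov⟩
    · rw [not_forall] at hcov
      obtain ⟨v0, hv0⟩ := hcov
      obtain ⟨v, u, hv, ⟨i, hi, rfl⟩, hvu⟩ := exists_boundary (fun u v => E u v ≠ 0)
        {v | ∃ i < m, v = a i} v0 (a 0) ⟨0, hm, rfl⟩ hv0 (hc _ _)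
      simp only [Set.mem_ofPred_eq, not_exists, not_and] at hv
      by_cases hi0 : i = 0
      · subst hi0
        refine ih (spine v a) (m + 1) (by omega) ⟨?_, ?_⟩ (by omega)
        · rintro (_ | i) hi (_ | j) hj e
          · rfl
          · exact absurd e (hv j (by omega))
          · exact absurd e.symm (hv i (by omega))
          · rw [h.inj i (by omega) j (by omega) e]
        · rintro (_ | i) hi
          · exact hvu
          · exact h.edge i (by omega)
      · by_cases him : i + 1 = m
        · have hu : ∀ j, j < m → Function.update a m v j = a j := fun j hj => by
            rw [Function.update_of_ne (by omega)]
          have hp : Function.update a m v m = v := Function.update_self ..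
          have hsplit : ∀ i, i < m + 1 → (i < m ∨ i = m) := fun i hi => by omega
          refine ih (Function.update a m v) (m + 1) (by omega) ⟨?_, ?_⟩ (by omega)
          · intro i hi j hj e
            rcases hsplit i hi with hi | hi <;> rcases hsplit j hj with hj | hj
            · rw [hu i hi, hu j hj] at e; exact h.inj i hi j hj e
            · rw [hu i hi, hj, hp] at e; exact absurd e.symm (hv i hi)
            · rw [hu j hj, hi, hp] at e; exact absurd e (hv j hj)
            · omega
          · intro j hj
            rcases hsplit (j + 1) hj with hj' | hj'
            · rw [hu j (by omega), hu (j + 1) hj']; exact h.edge j hj'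
            · have : j = i := by omega
              subst this
              rw [hu j hi, hj', hp, hs]; exact hvu
        · exfalso
          obtain ⟨i, rfl⟩ := Nat.exists_eq_succ_of_ne_zero hi0
          have e1 := h.edge i hi
          have e2 := h.edge (i + 1) (by omega)
          have n1 : a i ≠ a (i + 1) := fun e => by
            have := h.inj i (by omega) (i + 1) hi e; omega
          have n2 : a (i + 1 + 1) ≠ a (i + 1) := fun e => by
            have := h.inj (i + 1 + 1) (by omega) (i + 1) hi e; omega
          have n3 : a i ≠ a (i + 1 + 1) := fun e => by
            have := h.inj i (by omega) (i + 1 + 1) (by omega) e; omega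
          refine hst (a (i + 1)) (fun _ => a i) (fun _ => a (i + 1 + 1)) (fun _ => v) ?_
          constructor
          · exact fun _ _ => n1
          · exact fun _ _ => n2
          · exact fun _ _ => hv (i + 1) hi
          · intros; omega
          · intros; omega
          · intros; omega
          · exact fun _ _ _ _ => n3
          · exact fun _ _ _ _ => fun e => hv i (by omega) e.symm
          · exact fun _ _ _ _ => fun e => hv (i + 1 + 1) (by omega) e.symm
          · exact fun _ => by rw [hs]; exact e1
          · exact fun _ => e2
          · exact fun _ => by rw [hs]; exact hvu
          · intros; omega
          · intros; omega
          · intros; omega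

theorem path_dynkin {n : ℕ} {E : Fin n → Fin n → ℕ}
    (hs : ∀ x y, E x y = E y x) (h0 : ∀ x, E x x = 0) (hno : ¬ HasZ E)
    (a : ℕ → Fin n) (m : ℕ) (hm : 0 < m) (h : IsPth E a m) (hcov : ∀ v, ∃ i < m, v = a i) :
    IsDynkinADE n E := by
  have hbij : Function.Bijective (fun i : Fin m => a i) := by
    refine ⟨fun i j e => Fin.ext (h.inj i i.2 j j.2 e), fun v => ?_⟩
    obtain ⟨i, hi, rfl⟩ := hcov v
    exact ⟨⟨i, hi⟩, rfl⟩
  have hcard : n = m := by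
    have := Fintype.card_of_bijective hbij
    simp at this
    omega
  subst hcard
  have hex := exact_of_ge (fun i j : Fin n => armG i j) (fun i j : Fin n => E (a i) (a j))
    (fun _ _ => hs _ _) (fun _ => h0 _)
    (fun i j => by simp only [armG]; split_ifs <;> omega) ⟨0, hm⟩
    (by
      rintro ⟨i, hi⟩
      induction i with
      | zero => exact Relation.ReflTransGen.refl
      | succ i ih =>
        exact Relation.ReflTransGen.head (b := ⟨i, by omega⟩) (by simp [armG]) (ih (by omega)))
    (fun i j => armG_le hs h.edge i j i.2 j.2)
    (fun hz => hno (hasZ_emb _ E _ hbij.1 (fun _ _ => le_refl _) hz))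
  obtain ⟨e, he⟩ := dyn_of_label E (edgeA _) _ hbij id Function.injective_id
    (fun s t => (hex s t))
  exact ⟨e, Or.inl he⟩

theorem hasZ_of_not_dynkin {n : ℕ} (hn : 0 < n) {E : Fin n → Fin n → ℕ}
    (hs : ∀ x y, E x y = E y x) (h0 : ∀ x, E x x = 0)
    (hc : ∀ x y, Relation.ReflTransGen (fun u v => E u v ≠ 0) x y)
    (hD : ¬ IsDynkinADE n E) : HasZ E := by
  by_contra hno
  by_cases hst : ∀ o a b c, ¬ Star E o a b c 1 1 1
  · obtain ⟨a, m, hm, h, hcov⟩ := path_grow hs hc hst (n + 1) (fun _ => ⟨0, hn⟩) 1 (by omega)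
      ⟨by intros; omega, by intros; omega⟩ (by simp; omega)
    exact hD (path_dynkin hs h0 hno a m hm h hcov)
  · push Not at hst
    obtain ⟨o, a, b, c, h⟩ := hst
    obtain ⟨a, b, c, p, q, r, hp, hq, hr, h, hcov⟩ := star_grow hs hno hc n a b c 1 1 1
      (by omega) (by omega) (by omega) h (by simp)
    exact hD (star_dynkin hs h0 hno a b c p q r hp hq hr h hcov)

theorem final_z {n : ℕ} (hn : 2 ≤ n) (Λ : Fin n → Fin n → ℕ)
    (hloop : ∀ a, Λ a a = 0)
    (hconn : ∀ a b : Fin n, Relation.ReflTransGen (fun u v => edges Λ u v ≠ 0) a b)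
    (hnotADE : ¬ IsDynkinADE n (edges Λ)) :
    ∃ z : Fin n → ℤ, (∀ x, 0 < z x) ∧ ∀ x, ∑ l, cartanOf Λ x l * z l ≤ 0 := by
  obtain ⟨z, hz, h⟩ := sincere_of_hasZ _ hconn
    (hasZ_of_not_dynkin (by omega) (edges_symm Λ) (fun x => by simp [edges, hloop]) hconn hnotADE)
  refine ⟨fun i => (z i : ℤ), fun x => Int.natCast_pos.mpr (hz x), fun x => ?_⟩
  rw [cartan_sum Λ hloop]
  have := h x
  zify at this
  linarith

theorem final_main
    (n : ℕ) (hn : 2 ≤ n) (Λ : Fin n → Fin n → ℕ)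
    (hloop : ∀ a, Λ a a = 0)
    (hconn : ∀ a b : Fin n, Relation.ReflTransGen (fun u v => edges Λ u v ≠ 0) a b)
    (hacyc : ∀ a : Fin n, ¬ Relation.TransGen (fun u v => Λ u v ≠ 0) a a)
    (k : Type) [Field k]
    (hnotADE : ¬ IsDynkinADE n (edges Λ)) :
    ∀ S : List (Fin n), Admissible Λ S →
      IsReducedSeq Λ S ∧ ∃ M : Rep k n Λ, Preprojective Λ M ∧ IsShortestAnn Λ M S := by
  obtain ⟨z, hz0, hz⟩ := final_z hn Λ hloop hconn hnotADE
  exact fun S hS => ⟨reduced_of_sincere Λ hloop (root_pos k Λ hloop z hz0 hz) S hS,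
    shortest_exists k Λ hloop z hz0 hz S hS⟩

theorem non_Dynkin_all_words_reduced
    (n : ℕ) (hn : 2 ≤ n) (Λ : Fin n → Fin n → ℕ)
    (hloop : ∀ a, Λ a a = 0)
    (hconn : ∀ a b : Fin n, Relation.ReflTransGen (fun u v => edges Λ u v ≠ 0) a b)
    (hacyc : ∀ a : Fin n, ¬ Relation.TransGen (fun u v => Λ u v ≠ 0) a a)
    (k : Type) [Field k]
    (hnotADE : ¬ IsDynkinADE n (edges Λ)) :
    ∀ S : List (Fin n), Admissible Λ S →
      IsReducedSeq Λ S ∧ ∃ M : Rep k n Λ, Preprojective Λ M ∧ IsShortestAnn Λ M S := by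
  exact final_main n hn Λ hloop hconn hacyc k hnotADE

end KP
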